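/- arXiv:1001.0811 — 5 statements merged into one kernel-verified Lean document; each statement's English description precedes it below -/
import Mathlib

section
/- Let S and T be class types which are representable over the finite field F_q. Then S and T commute over F_q if and only if there exist a separation S* of S and a separation T* of T such that S* and T* commute componentwise over F_q. -/
open Polynomial Matrix

/-- Two square matrices over a commutative ring are *similar* if they are
conjugate by an invertible matrix. -/
def SimilarMat {m : Type*} [Fintype m] [DecidableEq m] {K : Type*} [CommRing K]
    (A B : Matrix m m K) : Prop :=
  ∃ P : (Matrix m m K)ˣ, B = (↑P : Matrix m m K) * A * (↑P⁻¹ : Matrix m m K)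

/-- `M` is similar to a direct sum of cyclic blocks, one for each pair `(f, h)`
in the list `c`, the block having characteristic polynomial and minimal
polynomial both equal to `f ^ h`. -/
def HasCycleTypeList {K : Type*} [Field K] {n : ℕ} (M : Matrix (Fin n) (Fin n) K)
    (c : List (Polynomial K × ℕ)) : Prop :=
  ∃ B : (i : Fin c.length) →
      Matrix (Fin ((c.get i).1.natDegree * (c.get i).2))
             (Fin ((c.get i).1.natDegree * (c.get i).2)) K,
    (∀ i, (B i).charpoly = (c.get i).1 ^ (c.get i).2 ∧
          minpoly K (B i) = (c.get i).1 ^ (c.get i).2) ∧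
    ∃ e : ((i : Fin c.length) × Fin ((c.get i).1.natDegree * (c.get i).2)) ≃ Fin n,
      SimilarMat (Matrix.reindex e e (Matrix.blockDiagonal' B)) M

/-- `M` has class type `T`, where a class type is recorded as the multiset of
pairs `(d_i, λ_i)` consisting of the degree `d_i` of each of the distinct monic
irreducible polynomials `f_i` occurring in the cycle type
`f_1^{λ_1} ⋯ f_t^{λ_t}` of `M`, together with the associated partition `λ_i`
(a nonempty multiset of positive parts). -/
def HasClassType {K : Type*} [Field K] {n : ℕ} (M : Matrix (Fin n) (Fin n) K)
    (T : Multiset (ℕ × Multiset ℕ)) : Prop :=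
  ∃ l : List (Polynomial K × Multiset ℕ),
    (l.map Prod.fst).Nodup ∧
    (∀ p ∈ l, p.1.Monic ∧ Irreducible p.1 ∧ p.2 ≠ 0 ∧ ∀ h ∈ p.2, 0 < h) ∧
    T = ↑(l.map fun p => (p.1.natDegree, p.2)) ∧
    ∃ c : List (Polynomial K × ℕ),
      (↑c : Multiset (Polynomial K × ℕ)) = (l.map fun p => p.2.map fun h => (p.1, h)).sum ∧
      HasCycleTypeList M c

/-- Class types `S` and `T` commute over `K` (in dimension `n`) if there exist
commuting `n × n` matrices over `K` with class types `S` and `T` respectively. -/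
def TypesCommute (K : Type*) [Field K] (n : ℕ) (S T : Multiset (ℕ × Multiset ℕ)) : Prop :=
  ∃ X Y : Matrix (Fin n) (Fin n) K, HasClassType X S ∧ HasClassType Y T ∧ Commute X Y

/-- One separation operation: replace a primary component `(d, l)` of a type
by the two components `(d, m)`, `(d, v)`, where `l = m + v` as multisets and
`m`, `v` are nonempty. -/
def SepStep (T T' : Multiset (ℕ × Multiset ℕ)) : Prop :=
  ∃ (d : ℕ) (l m v : Multiset ℕ) (T₀ : Multiset (ℕ × Multiset ℕ)),
    T = (d, l) ::ₘ T₀ ∧ m ≠ 0 ∧ v ≠ 0 ∧ l = m + v ∧ T' = (d, m) ::ₘ (d, v) ::ₘ T₀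

/-- A separation of a type is obtained by repeatedly applying separation
operations (possibly none). -/
def Separation : Multiset (ℕ × Multiset ℕ) → Multiset (ℕ × Multiset ℕ) → Prop :=
  Relation.ReflTransGen SepStep

/-- The primary types `P` and `Q` commute over `K`: there exist commuting
matrices over `K` of some common dimension with class types `P` and `Q`. -/
def PrimaryTypesCommute (K : Type*) [Field K] (P Q : ℕ × Multiset ℕ) : Prop :=
  ∃ m : ℕ, TypesCommute K m {P} {Q}

/-- Types `S` and `T` commute componentwise over `K`: their primary components
can be listed as `c_1^{λ_1} ⋯ c_t^{λ_t}` and `d_1^{μ_1} ⋯ d_t^{μ_t}` so that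
`c_i^{λ_i}` commutes with `d_i^{μ_i}` over `K` for each `i`. -/
def ComponentwiseCommute (K : Type*) [Field K] (S T : Multiset (ℕ × Multiset ℕ)) : Prop :=
  ∃ s t : List (ℕ × Multiset ℕ),
    (↑s : Multiset (ℕ × Multiset ℕ)) = S ∧ (↑t : Multiset (ℕ × Multiset ℕ)) = T ∧
    s.length = t.length ∧
    ∀ (i : ℕ) (hs : i < s.length) (ht : i < t.length),
      PrimaryTypesCommute K (s.get ⟨i, hs⟩) (t.get ⟨i, ht⟩)

section KernelDimensions

open Module LinearMap

variable {K : Type*} [Field K]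

/-- The members of `C` are pairs of a monic irreducible polynomial and a positive exponent. -/
def IsElementary (C : Multiset (K[X] × ℕ)) : Prop :=
  ∀ p ∈ C, p.1.Monic ∧ Irreducible p.1 ∧ 0 < p.2

open Classical in
/-- The sum of `min j h` over all pairs `(f, h)` of `C` with first entry `f`. -/
noncomputable def levelSum (C : Multiset (K[X] × ℕ)) (f : K[X]) (j : ℕ) : ℕ :=
  (C.map fun p => if p.1 = f then min j p.2 else 0).sum

@[simp] theorem levelSum_zero (f : K[X]) (j : ℕ) : levelSum 0 f j = 0 := rfl

theorem levelSum_add (C D : Multiset (K[X] × ℕ)) (f : K[X]) (j : ℕ) :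
    levelSum (C + D) f j = levelSum C f j + levelSum D f j := by
  simp [levelSum]

open Classical in
theorem levelSum_cons (p : K[X] × ℕ) (C : Multiset (K[X] × ℕ)) (f : K[X]) (j : ℕ) :
    levelSum (p ::ₘ C) f j = (if p.1 = f then min j p.2 else 0) + levelSum C f j := by
  simp [levelSum]

open Classical in
theorem levelSum_second_difference (C : Multiset (K[X] × ℕ)) (f : K[X]) (j : ℕ) :
    levelSum C f j + levelSum C f (j + 2) + C.count (f, j + 1) = 2 * levelSum C f (j + 1) := by
  induction C using Multiset.induction_on with
  | empty => simp
  | cons p C ih =>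
    obtain ⟨g, h⟩ := p
    simp only [levelSum_cons, Multiset.count_cons, Prod.mk.injEq]
    by_cases hg : g = f
    · by_cases hj : j + 1 = h
      · subst hg hj
        simp
        omega
      · simp only [hg, hj]
        simp
        omega
    · simp [hg, Ne.symm hg]
      omega

theorem levelSum_eq_sum (f : K[X]) (l : Multiset ℕ) (j : ℕ) (hj : ∀ h ∈ l, h ≤ j) :
    levelSum (l.map fun h => (f, h)) f j = l.sum := by
  induction l using Multiset.induction_on with
  | empty => simp
  | cons a l ih =>
    rw [Multiset.map_cons, levelSum_cons, ih fun h hh => hj h (Multiset.mem_cons_of_mem hh)]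
    simp [hj a (Multiset.mem_cons_self a l)]

theorem levelSum_map_prod (f g : K[X]) (l : Multiset ℕ) (j : ℕ) :
    levelSum (l.map fun h => (f, h)) f j = levelSum (l.map fun h => (g, h)) g j := by
  simp [levelSum]

theorem levelSum_map_ne {f g : K[X]} (hfg : f ≠ g) (l : Multiset ℕ) (j : ℕ) :
    levelSum (l.map fun h => (f, h)) g j = 0 := by
  simp [levelSum, hfg]

variable {V : Type*} [AddCommGroup V] [Module K V]

/-- The dimensions of the kernels of the powers of `f(φ)`, for every monic irreducible `f`, are
those of a direct sum of cyclic blocks indexed by `C`. -/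
def HasElementaryDivisors (φ : End K V) (C : Multiset (K[X] × ℕ)) : Prop :=
  ∀ f : K[X], f.Monic → Irreducible f → ∀ j : ℕ,
    finrank K (ker (aeval φ (f ^ j))) = f.natDegree * levelSum C f j

theorem HasElementaryDivisors.unique {φ : End K V} {C D : Multiset (K[X] × ℕ)}
    (hC : HasElementaryDivisors φ C) (hD : HasElementaryDivisors φ D)
    (hC' : IsElementary C) (hD' : IsElementary D) : C = D := by
  classical
  ext ⟨f, h⟩
  by_cases hf : f.Monic ∧ Irreducible f ∧ 0 < h
  · obtain ⟨hm, hi, h0⟩ := hf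
    have key : ∀ j, levelSum C f j = levelSum D f j := fun j =>
      Nat.eq_of_mul_eq_mul_left hi.natDegree_pos ((hC f hm hi j).symm.trans (hD f hm hi j))
    obtain ⟨j, rfl⟩ : ∃ j, h = j + 1 := ⟨h - 1, by omega⟩
    have h1 := levelSum_second_difference C f j
    have h2 := levelSum_second_difference D f j
    rw [key, key, key] at h1
    omega
  · rw [Multiset.count_eq_zero_of_notMem fun hm => hf (hC' _ hm),
      Multiset.count_eq_zero_of_notMem fun hm => hf (hD' _ hm)]

theorem aeval_intertwine {W : Type*} [AddCommGroup W] [Module K W] {φ : End K V} {ψ : End K W}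
    (T : V →ₗ[K] W) (h : ∀ v, T (φ v) = ψ (T v)) (p : K[X]) (v : V) :
    T (aeval φ p v) = aeval ψ p (T v) := by
  induction p using Polynomial.induction_on' generalizing v with
  | add p q hp hq => simp [hp, hq]
  | monomial n a =>
    have : ∀ v, T ((φ ^ n) v) = (ψ ^ n) (T v) := by
      induction n with
      | zero => simp
      | succ n ih => intro v; simp [pow_succ, ih, h]
    simp [aeval_monomial, this]

theorem finrank_ker_aeval_pi {ι : Type*} [Fintype ι] {W : ι → Type*}
    [∀ i, AddCommGroup (W i)] [∀ i, Module K (W i)] [∀ i, FiniteDimensional K (W i)]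
    {φ : End K V} {ψ : ∀ i, End K (W i)} (E : V ≃ₗ[K] ∀ i, W i)
    (hE : ∀ v i, E (φ v) i = ψ i (E v i)) (p : K[X]) :
    finrank K (ker (aeval φ p)) = ∑ i, finrank K (ker (aeval (ψ i) p)) := by
  have hp : ∀ v i, E (aeval φ p v) i = aeval (ψ i) p (E v i) := fun v i =>
    aeval_intertwine (LinearMap.proj i ∘ₗ E.toLinearMap) (fun v => hE v i) p v
  have hmem : ∀ v, v ∈ ker (aeval φ p) ↔ ∀ i, E v i ∈ ker (aeval (ψ i) p) := fun v => by
    simp only [mem_ker, ← hp]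
    rw [← E.map_eq_zero_iff, funext_iff]
    rfl
  rw [← finrank_pi_fintype K]
  exact LinearEquiv.finrank_eq
    { toFun := fun v i => ⟨E v i, (hmem v).1 v.2 i⟩
      invFun := fun w => ⟨E.symm fun i => w i, (hmem _).2 fun i => by simp⟩
      map_add' := fun v w => by ext; simp
      map_smul' := fun c v => by ext; simp
      left_inv := fun v => by ext; simp
      right_inv := fun w => by ext; simp }

theorem HasElementaryDivisors.conj {W : Type*} [AddCommGroup W] [Module K W] {φ : End K V}
    {ψ : End K W} {C : Multiset (K[X] × ℕ)} (hφ : HasElementaryDivisors φ C) (E : V ≃ₗ[K] W)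
    (hE : ∀ v, E (φ v) = ψ (E v)) : HasElementaryDivisors ψ C := by
  intro f hm hi j
  rw [← hφ f hm hi j]
  have hp := aeval_intertwine E.toLinearMap hE (f ^ j)
  refine (LinearEquiv.finrank_eq (E.ofSubmodules _ _ ?_)).symm
  ext w
  obtain ⟨v, rfl⟩ := E.surjective w
  simp only [Submodule.mem_map, mem_ker]
  have := hp v
  simp only [LinearEquiv.coe_coe] at this
  constructor
  · rintro ⟨u, hu, huv⟩
    obtain rfl := E.injective huv
    rw [← this, hu, map_zero]
  · intro h
    refine ⟨v, ?_, rfl⟩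
    rwa [← this, E.map_eq_zero_iff] at h

theorem HasElementaryDivisors.prodMap {W : Type*} [AddCommGroup W] [Module K W]
    [FiniteDimensional K V] [FiniteDimensional K W] {φ : End K V} {ψ : End K W}
    {C D : Multiset (K[X] × ℕ)} (hφ : HasElementaryDivisors φ C)
    (hψ : HasElementaryDivisors ψ D) :
    HasElementaryDivisors (LinearMap.prodMap φ ψ : End K (V × W)) (C + D) := by
  intro f hm hi j
  rw [levelSum_add, mul_add, ← hφ f hm hi j, ← hψ f hm hi j]
  have h1 := aeval_intertwine (φ := (LinearMap.prodMap φ ψ : End K (V × W))) (ψ := φ)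
    (LinearMap.fst K V W) (fun v => rfl) (f ^ j)
  have h2 := aeval_intertwine (φ := (LinearMap.prodMap φ ψ : End K (V × W))) (ψ := ψ)
    (LinearMap.snd K V W) (fun v => rfl) (f ^ j)
  have : (aeval (LinearMap.prodMap φ ψ : End K (V × W))) (f ^ j) =
      LinearMap.prodMap (aeval φ (f ^ j)) (aeval ψ (f ^ j)) := by
    refine LinearMap.ext fun v => ?_
    exact Prod.ext (h1 v) (h2 v)
  rw [this, LinearMap.ker_prodMap, ← Module.finrank_prod]
  exact LinearEquiv.finrank_eq
    { toFun := fun v => (⟨v.1.1, v.2.1⟩, ⟨v.1.2, v.2.2⟩)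
      invFun := fun v => ⟨(v.1, v.2), v.1.2, v.2.2⟩
      map_add' := fun _ _ => rfl
      map_smul' := fun _ _ => rfl
      left_inv := fun _ => rfl
      right_inv := fun _ => rfl }

theorem ker_aeval_eq_bot_of_isCoprime {φ : End K V} {p q : K[X]} (h : IsCoprime p q)
    (hq : aeval φ q = 0) : ker (aeval φ p) = ⊥ := by
  obtain ⟨a, b, hab⟩ := h
  rw [eq_bot_iff]
  intro v hv
  have := congrArg (fun r => aeval φ r v) hab
  simpa [hq, mem_ker.1 hv] using this.symm

theorem isCoprime_of_monic_irreducible {f g : K[X]} (hf : f.Monic) (hg : g.Monic)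
    (hfi : Irreducible f) (hgi : Irreducible g) (h : f ≠ g) : IsCoprime f g :=
  (hfi.isCoprime_or_dvd g).resolve_right fun hd =>
    h (eq_of_monic_of_associated hf hg (hfi.associated_of_dvd hgi hd))

theorem finrank_ker_pow_add_natDegree_le [FiniteDimensional K V] {φ : End K V} {g : K[X]}
    (hg : Irreducible g) {j : ℕ} {v : V} (hv : aeval φ (g ^ (j + 1)) v = 0)
    (hv' : aeval φ (g ^ j) v ≠ 0) :
    g.natDegree + finrank K (ker (aeval φ (g ^ j))) ≤
      finrank K (ker (aeval φ (g ^ (j + 1)))) := by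
  have hcomm : ∀ (p q : K[X]) (w : V), aeval φ p (aeval φ q w) = aeval φ q (aeval φ p w) := by
    intro p q w
    rw [← Module.End.mul_apply, ← map_mul, mul_comm, map_mul, Module.End.mul_apply]
  let ev : K[X] →ₗ[K] V := (LinearMap.applyₗ v) ∘ₗ (aeval φ).toLinearMap
  have hev : ∀ p, ev p = aeval φ p v := fun p => rfl
  let T : degreeLT K g.natDegree × ker (aeval φ (g ^ j)) →ₗ[K] V :=
    (ev ∘ₗ (degreeLT K g.natDegree).subtype).coprod (ker (aeval φ (g ^ j))).subtype
  have hT : ∀ x, T x = aeval φ x.1.1 v + x.2.1 := fun x => rfl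
  have hTmem : ∀ x, T x ∈ ker (aeval φ (g ^ (j + 1))) := by
    intro x
    rw [mem_ker, hT, map_add, hcomm, hv, map_zero, zero_add, pow_succ', map_mul,
      Module.End.mul_apply, mem_ker.1 x.2.2, map_zero]
  have hinj : ker T = ⊥ := by
    rw [eq_bot_iff]
    rintro ⟨⟨p, hp⟩, ⟨w, hw⟩⟩ hx
    rw [mem_ker, hT] at hx
    simp only at hx
    have hp0 : p = 0 := by
      by_contra hne
      have hco : IsCoprime g p := (hg.isCoprime_or_dvd p).resolve_right fun hd => by
        have := natDegree_le_of_dvd hd hne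
        rw [mem_degreeLT, degree_eq_natDegree hne] at hp
        have : p.natDegree < g.natDegree := by exact_mod_cast hp
        omega
      obtain ⟨a, b, hab⟩ := hco
      apply hv'
      have h1 : aeval φ (g ^ j) (aeval φ p v) = 0 := by
        have := congrArg (aeval φ (g ^ j)) hx
        rwa [map_add, mem_ker.1 hw, add_zero, map_zero] at this
      have h2 : g ^ j = a * g ^ (j + 1) + b * (g ^ j * p) := by
        linear_combination (-g ^ j) * hab
      rw [h2]
      simp only [map_add, LinearMap.add_apply, map_mul, Module.End.mul_apply] at *
      rw [hv, h1]
      simp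
    subst hp0
    simp at hx
    subst hx
    rfl
  have := LinearMap.finrank_le_finrank_of_injective
    (f := T.codRestrict (ker (aeval φ (g ^ (j + 1)))) hTmem)
    (ker_eq_bot.1 (by rw [ker_codRestrict, hinj]))
  rwa [Module.finrank_prod, (degreeLTEquiv K g.natDegree).finrank_eq, Module.finrank_fin_fun]
    at this

theorem finrank_ker_pow_of_charpoly_eq_minpoly [FiniteDimensional K V] {φ : End K V} {g : K[X]}
    {h : ℕ} (hm : g.Monic) (hg : Irreducible g) (hc : φ.charpoly = g ^ h)
    (hmin : minpoly K φ = g ^ h) (j : ℕ) :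
    finrank K (ker (aeval φ (g ^ j))) = g.natDegree * min j h := by
  have hdim : finrank K V = g.natDegree * h := by
    rw [← φ.charpoly_natDegree, hc, natDegree_pow, mul_comm]
  have hzero : aeval φ (g ^ h) = 0 := by rw [← hmin, minpoly.aeval]
  have hstep : ∀ j < h, g.natDegree + finrank K (ker (aeval φ (g ^ j))) ≤
      finrank K (ker (aeval φ (g ^ (j + 1)))) := by
    intro j hj
    have hne : aeval φ (g ^ (h - 1)) ≠ 0 := by
      intro h0
      have h1 := minpoly.dvd K φ h0
      rw [hmin, pow_dvd_pow_iff hm.ne_zero hg.not_isUnit] at h1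
      omega
    obtain ⟨w, hw⟩ : ∃ w, aeval φ (g ^ (h - 1)) w ≠ 0 := by
      by_contra! hcon
      exact hne (LinearMap.ext hcon)
    refine finrank_ker_pow_add_natDegree_le hg (v := aeval φ (g ^ (h - 1 - j)) w) ?_ ?_
    · rw [← Module.End.mul_apply, ← map_mul, ← pow_add,
        show j + 1 + (h - 1 - j) = h by omega, hzero]
      rfl
    · rwa [← Module.End.mul_apply, ← map_mul, ← pow_add, show j + (h - 1 - j) = h - 1 by omega]
  have hlow : ∀ j ≤ h, g.natDegree * j ≤ finrank K (ker (aeval φ (g ^ j))) := by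
    intro j hj
    induction j with
    | zero => simp
    | succ j ih =>
      have := hstep j hj
      have := ih (by omega)
      rw [mul_add, mul_one]
      omega
  have hup : ∀ i ≤ h, finrank K (ker (aeval φ (g ^ (h - i)))) + g.natDegree * i ≤
      g.natDegree * h := by
    intro i hi
    induction i with
    | zero => rw [← hdim, mul_zero, add_zero]; exact Submodule.finrank_le _
    | succ i ih =>
      have h1 := hstep (h - (i + 1)) (by omega)
      have h2 := ih (by omega)
      rw [show h - (i + 1) + 1 = h - i by omega] at h1
      rw [mul_add, mul_one]
      omega
  rcases le_total j h with hj | hj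
  · have h1 := hlow j hj
    have h2 := hup (h - j) (by omega)
    rw [show h - (h - j) = j by omega] at h2
    have h3 : g.natDegree * h = g.natDegree * j + g.natDegree * (h - j) := by
      rw [← mul_add]; congr 1; omega
    rw [min_eq_left hj]
    omega
  · have : aeval φ (g ^ j) = 0 := by
      rw [← Nat.sub_add_cancel hj, pow_add, map_mul, hzero, mul_zero]
    rw [this, ker_zero, finrank_top, hdim, min_eq_right hj]

end KernelDimensions

section CyclicBlocks

open Module LinearMap

variable {K : Type*} [Field K]

theorem HasCycleTypeList.exists_linearEquiv {n : ℕ} {M : Matrix (Fin n) (Fin n) K}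
    {c : List (K[X] × ℕ)} (h : HasCycleTypeList M c) :
    ∃ B : (i : Fin c.length) →
      Matrix (Fin ((c.get i).1.natDegree * (c.get i).2))
             (Fin ((c.get i).1.natDegree * (c.get i).2)) K,
    (∀ i, (B i).charpoly = (c.get i).1 ^ (c.get i).2 ∧
          minpoly K (B i) = (c.get i).1 ^ (c.get i).2) ∧
    ∃ E : (Fin n → K) ≃ₗ[K] ((i : Fin c.length) →
        (Fin ((c.get i).1.natDegree * (c.get i).2) → K)),
      ∀ v i, E (toLin' M v) i = toLin' (B i) (E v i) := by
  obtain ⟨B, hB, e, P, hP⟩ := h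
  refine ⟨B, hB, (toLin'OfInv (M' := ((P⁻¹ : (Matrix _ _ K)ˣ) : Matrix _ _ K)) (M := (P : Matrix _ _ K))
    (by simp) (by simp)).trans ((LinearEquiv.funCongrLeft K K e).trans
      (LinearEquiv.piCurry K fun _ _ => K)), ?_⟩
  intro v i
  ext k
  set Q : Matrix (Fin n) (Fin n) K := ↑P⁻¹ with hQ
  have hM : Q * M = reindex e e (blockDiagonal' B) * Q := by
    rw [hP, ← mul_assoc, ← mul_assoc, hQ, Units.inv_mul, one_mul]
  have h1 : toLin' Q (toLin' M v) =
      toLin' (reindex e e (blockDiagonal' B)) (toLin' Q v) := by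
    rw [← toLin'_mul_apply, hM, toLin'_mul_apply]
  change toLin' Q (toLin' M v) (e ⟨i, k⟩) =
    toLin' (B i) (fun k => toLin' Q v (e ⟨i, k⟩)) k
  rw [h1]
  generalize toLin' Q v = w
  simp only [toLin'_apply, mulVec, dotProduct]
  rw [← e.sum_comp, Fintype.sum_sigma, Finset.sum_eq_single i]
  · simp
  · intro j _ hj
    refine Finset.sum_eq_zero fun k' _ => ?_
    simp [blockDiagonal'_apply_ne _ _ _ hj.symm]
  · simp

theorem HasCycleTypeList.hasElementaryDivisors {n : ℕ} {M : Matrix (Fin n) (Fin n) K}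
    {c : List (K[X] × ℕ)} (h : HasCycleTypeList M c)
    (hc : IsElementary (c : Multiset (K[X] × ℕ))) :
    HasElementaryDivisors (toLin' M) c := by
  classical
  obtain ⟨B, hB, E, hE⟩ := h.exists_linearEquiv
  intro f hm hi j
  rw [finrank_ker_aeval_pi E hE]
  have key : ∀ i, finrank K (ker (aeval (toLin' (B i)) (f ^ j))) =
      f.natDegree * (fun p : K[X] × ℕ => if p.1 = f then min j p.2 else 0) (c.get i) := by
    intro i
    have hmin : minpoly K (toLin' (B i)) = (c.get i).1 ^ (c.get i).2 := by
      rw [Matrix.minpoly_toLin', (hB i).2]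
    have hchar : (toLin' (B i)).charpoly = (c.get i).1 ^ (c.get i).2 := by
      rw [Matrix.charpoly_toLin', (hB i).1]
    obtain ⟨h1, h2, -⟩ := hc (c.get i) (by simp)
    by_cases hf : (c.get i).1 = f
    · subst hf
      simp only [if_true]
      exact finrank_ker_pow_of_charpoly_eq_minpoly h1 h2 hchar hmin j
    · simp only [hf, if_false, mul_zero]
      have h0 : aeval (toLin' (B i)) ((c.get i).1 ^ (c.get i).2) = 0 := by
        rw [← hmin, minpoly.aeval]
      rw [ker_aeval_eq_bot_of_isCoprime _ h0, finrank_bot]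
      exact (isCoprime_of_monic_irreducible hm h1 hi h2 (Ne.symm hf)).pow
  rw [Finset.sum_congr rfl fun i _ => key i, ← Finset.mul_sum, levelSum]
  congr 1
  rw [Multiset.map_coe, Multiset.sum_coe, ← Fin.sum_univ_fun_getElem]
  rfl

theorem HasCycleTypeList.card_eq {n : ℕ} {M : Matrix (Fin n) (Fin n) K}
    {c : List (K[X] × ℕ)} (h : HasCycleTypeList M c) :
    n = ((c : Multiset (K[X] × ℕ)).map fun p => p.1.natDegree * p.2).sum := by
  obtain ⟨B, hB, e, -⟩ := h
  have := Fintype.card_congr e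
  rw [Fintype.card_fin, Fintype.card_sigma] at this
  rw [Multiset.map_coe, Multiset.sum_coe, ← Fin.sum_univ_fun_getElem, ← this]
  simp

theorem hasCycleTypeList_of_linearEquiv {n : ℕ} {M : Matrix (Fin n) (Fin n) K}
    {c : List (K[X] × ℕ)} {W : Fin c.length → Type*} [∀ i, AddCommGroup (W i)]
    [∀ i, Module K (W i)] [∀ i, FiniteDimensional K (W i)] (ψ : ∀ i, End K (W i))
    (hchar : ∀ i, (ψ i).charpoly = (c.get i).1 ^ (c.get i).2)
    (hmin : ∀ i, minpoly K (ψ i) = (c.get i).1 ^ (c.get i).2)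
    (E : (Fin n → K) ≃ₗ[K] ∀ i, W i) (hE : ∀ v i, E (toLin' M v) i = ψ i (E v i)) :
    HasCycleTypeList M c := by
  have hdim : ∀ i, finrank K (W i) = (c.get i).1.natDegree * (c.get i).2 := fun i => by
    rw [← (ψ i).charpoly_natDegree, hchar, natDegree_pow, mul_comm]
  let b : ∀ i, Basis (Fin ((c.get i).1.natDegree * (c.get i).2)) K (W i) :=
    fun i => finBasisOfFinrankEq K (W i) (hdim i)
  refine ⟨fun i => LinearMap.toMatrix (b i) (b i) (ψ i), fun i => ⟨?_, ?_⟩, ?_⟩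
  · rw [LinearMap.charpoly_toMatrix, hchar]
  · rw [LinearMap.minpoly_toMatrix, hmin]
  let b' := (Pi.basis b).map E.symm
  have hcard : Fintype.card ((i : Fin c.length) × Fin ((c.get i).1.natDegree * (c.get i).2)) =
      Fintype.card (Fin n) := by
    rw [← finrank_eq_card_basis b', finrank_eq_card_basis (Pi.basisFun K (Fin n))]
  let e := Fintype.equivOfCardEq hcard
  let b'' := b'.reindex e
  refine ⟨e, ⟨⟨(Pi.basisFun K (Fin n)).toMatrix b'', b''.toMatrix (Pi.basisFun K (Fin n)), ?_, ?_⟩,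
    ?_⟩⟩
  · exact Basis.toMatrix_mul_toMatrix_flip _ _
  · exact Basis.toMatrix_mul_toMatrix_flip _ _
  have hblock : reindex e e (blockDiagonal' fun i => LinearMap.toMatrix (b i) (b i) (ψ i)) =
      LinearMap.toMatrix b'' b'' (toLin' M) := by
    ext x y
    obtain ⟨⟨i, k⟩, rfl⟩ := e.surjective x
    obtain ⟨⟨j, l⟩, rfl⟩ := e.surjective y
    have h1 : E (b'' (e ⟨j, l⟩)) = Pi.single j (b j l) := by
      simp [b'', b', Pi.basis_apply]
    rw [LinearMap.toMatrix_apply]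
    have h2 : b''.repr (toLin' M (b'' (e ⟨j, l⟩))) (e ⟨i, k⟩) =
        (b i).repr (E (toLin' M (b'' (e ⟨j, l⟩))) i) k := by
      simp [b'', b', Pi.basis_repr]
    rw [h2, hE, h1]
    by_cases hij : i = j
    · subst hij
      simp [LinearMap.toMatrix_apply, blockDiagonal'_apply_eq]
    · simp [blockDiagonal'_apply_ne _ _ _ hij, Pi.single_eq_of_ne hij]
  rw [hblock]
  change M = (Pi.basisFun K (Fin n)).toMatrix b'' * LinearMap.toMatrix b'' b'' (toLin' M) *
    b''.toMatrix (Pi.basisFun K (Fin n))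
  rw [basis_toMatrix_mul_linearMap_toMatrix_mul_basis_toMatrix]
  rw [← toLin_eq_toLin', LinearMap.toMatrix_toLin]

theorem charpoly_mul_root {g : K[X]} (hg : g.Monic) [Module.Finite K (AdjoinRoot g)] :
    (LinearMap.mulLeft K (AdjoinRoot.root g)).charpoly = g := by
  have h := charpoly_leftMulMatrix (AdjoinRoot.powerBasis hg.ne_zero)
  rw [Algebra.leftMulMatrix_apply, LinearMap.charpoly_toMatrix, AdjoinRoot.powerBasis_gen,
    AdjoinRoot.minpoly_root hg.ne_zero, hg.leadingCoeff, inv_one, C_1, mul_one] at h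
  exact h

theorem minpoly_mul_root {g : K[X]} (hg : g.Monic) :
    minpoly K (LinearMap.mulLeft K (AdjoinRoot.root g)) = g := by
  have h : minpoly K (Algebra.lmul K (AdjoinRoot g) (AdjoinRoot.root g)) =
      minpoly K (AdjoinRoot.root g) := minpoly.algHom_eq _ Algebra.lmul_injective _
  rw [AdjoinRoot.minpoly_root hg.ne_zero, hg.leadingCoeff, inv_one, C_1, mul_one] at h
  exact h

theorem exists_hasCycleTypeList {n : ℕ} (M : Matrix (Fin n) (Fin n) K) :
    ∃ c : List (K[X] × ℕ), IsElementary (c : Multiset (K[X] × ℕ)) ∧ HasCycleTypeList M c := by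
  classical
  obtain ⟨ι, _, p, hp, e, ⟨E⟩⟩ := Module.equiv_directSum_of_isTorsion
    (Module.AEval.isTorsion_of_finiteDimensional K (Fin n → K) (toLin' M))
  let q : ι → K[X] := fun i => normalize (p i)
  have hq : ∀ i, Irreducible (q i) := fun i => (normalize_associated (p i)).symm.irreducible (hp i)
  have hqm : ∀ i, (q i).Monic := fun i => monic_normalize (hp i).ne_zero
  let J := {i : ι // e i ≠ 0}
  let r := Fintype.card J
  let σ : Fin r ≃ J := (Fintype.equivFin J).symm
  let c : List (K[X] × ℕ) := List.ofFn fun k => (q (σ k), e (σ k))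
  let τ : Fin c.length ≃ J := (finCongr (by simp [c])).trans σ
  have hc : ∀ i, c.get i = (q (τ i), e (τ i)) := fun i => by
    simp only [c, τ, List.get_ofFn]
    rfl
  refine ⟨c, ?_, ?_⟩
  · intro x hx
    obtain ⟨k, rfl⟩ : ∃ k, (q (σ k), e (σ k)) = x := by simpa [c, List.mem_ofFn] using hx
    exact ⟨hqm _, hq _, Nat.pos_of_ne_zero (σ k).2⟩
  · have hspan : ∀ i, Ideal.span {p i ^ e i} = Ideal.span {q i ^ e i} := fun i => by
      rw [Ideal.span_singleton_eq_span_singleton]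
      exact ((normalize_associated (p i)).symm).pow_pow
    let W : ι → Type _ := fun i => AdjoinRoot (q i ^ e i)
    have hfin : ∀ i, Module.Finite K (W i) := fun i => ((hqm i).pow (e i)).finite_adjoinRoot
    let g : ∀ i, (K[X] ⧸ Ideal.span {p i ^ e i}) ≃ₗ[K[X]] (K[X] ⧸ Ideal.span {q i ^ e i}) :=
      fun i => Submodule.quotEquivOfEq _ _ (hspan i)
    let g' : ∀ i, (K[X] ⧸ Ideal.span {p i ^ e i}) ≃ₗ[K] W i :=
      fun i => (g i).restrictScalars K
    have hg' : ∀ i v, g' i ((X : K[X]) • v) = AdjoinRoot.root (q i ^ e i) * g' i v := by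
      intro i v
      change g i ((X : K[X]) • v) = _
      rw [map_smul]
      rfl
    let E1 : (Fin n → K) ≃ₗ[K] ∀ i, W i :=
      (Module.AEval.of K (Fin n → K) (toLin' M)).trans ((E.restrictScalars K).trans
        ((DirectSum.linearEquivFunOnFintype K ι fun i => K[X] ⧸ Ideal.span {p i ^ e i}).trans
          (LinearEquiv.piCongrRight g')))
    have hE1 : ∀ v i, E1 (toLin' M v) i = AdjoinRoot.root (q i ^ e i) * E1 v i := by
      intro v i
      refine Eq.trans ?_ (hg' i _)
      change g' i (E (Module.AEval.of K (Fin n → K) (toLin' M) (toLin' M v)) i) =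
        g' i ((X : K[X]) • E (Module.AEval.of K (Fin n → K) (toLin' M) v) i)
      have : (X : K[X]) • Module.AEval.of K (Fin n → K) (toLin' M) v =
          Module.AEval.of K (Fin n → K) (toLin' M) (toLin' M v) := Module.AEval'.X_smul_of _ v
      rw [← this, map_smul]
      rfl
    have hsub : ∀ i, e i = 0 → ∀ x : W i, x = 0 := by
      intro i hi x
      have : Subsingleton (W i) := by
        change Subsingleton (AdjoinRoot (q i ^ e i))
        rw [hi, pow_zero]
        exact Ideal.Quotient.subsingleton_iff.2 (Ideal.span_singleton_one)
      exact Subsingleton.elim _ _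
    let E2 : (∀ i, W i) ≃ₗ[K] ∀ j : J, W j :=
      { toFun := fun f j => f j
        invFun := fun f i => if h : e i ≠ 0 then f ⟨i, h⟩ else 0
        map_add' := fun _ _ => rfl
        map_smul' := fun _ _ => rfl
        left_inv := fun f => by
          funext i
          by_cases h : e i = 0
          · simp [h, hsub i h (f i)]
          · simp [h]
        right_inv := fun f => by
          funext j
          exact dif_pos j.2 }
    let E3 : (∀ j : J, W j) ≃ₗ[K] ∀ i : Fin c.length, W (τ i) :=
      LinearEquiv.piCongrLeft' K (fun j : J => W j) τ.symm
    refine hasCycleTypeList_of_linearEquiv (W := fun i => W (τ i))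
      (fun i => LinearMap.mulLeft K (AdjoinRoot.root (q (τ i) ^ e (τ i)))) ?_ ?_
      (E1.trans (E2.trans E3)) fun v i => hE1 v (τ i)
    · intro i
      rw [hc]
      exact charpoly_mul_root ((hqm _).pow _)
    · intro i
      rw [hc]
      exact minpoly_mul_root ((hqm _).pow _)

end CyclicBlocks

section IrreducibleReplacement

open Module LinearMap

variable {K : Type*} [Field K]

theorem exists_comp_eq_mul_of_natDegree_eq [Finite K] {f g : K[X]} (hf : Irreducible f)
    (hg : Irreducible g) (h : f.natDegree = g.natDegree) :
    ∃ p u : K[X], f.comp p = g * u ∧ IsCoprime g u := by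
  have := Fact.mk hf
  have := Fact.mk hg
  obtain ⟨ℓ, _⟩ := CharP.exists K
  have := Fact.mk (CharP.char_is_prime K ℓ)
  have hfin : ∀ q : K[X], Irreducible q → finrank K (AdjoinRoot q) = q.natDegree := fun q hq =>
    (AdjoinRoot.powerBasis hq.ne_zero).finrank.trans (AdjoinRoot.powerBasis_dim hq.ne_zero)
  have hff : Module.Finite K (AdjoinRoot f) := (AdjoinRoot.powerBasis hf.ne_zero).finite
  have hgf : Module.Finite K (AdjoinRoot g) := (AdjoinRoot.powerBasis hg.ne_zero).finite
  have : Finite (AdjoinRoot f) := Module.finite_of_finite K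
  have : Finite (AdjoinRoot g) := Module.finite_of_finite K
  have hpos : NeZero f.natDegree := ⟨hf.natDegree_pos.ne'⟩
  let E : AdjoinRoot f ≃ₐ[K] AdjoinRoot g :=
    (FiniteField.algEquivExtension K ℓ f.natDegree (AdjoinRoot f) (hfin f hf)).trans
      (FiniteField.algEquivExtension K ℓ f.natDegree (AdjoinRoot g)
        ((hfin g hg).trans h.symm)).symm
  obtain ⟨p, hp⟩ := AdjoinRoot.mk_surjective (E (AdjoinRoot.root f))
  have hdvd : g ∣ aeval p f := by
    rw [← AdjoinRoot.mk_eq_zero]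
    change AdjoinRoot.mkₐ g (aeval p f) = 0
    rw [← aeval_algHom_apply]
    change aeval (AdjoinRoot.mk g p) f = 0
    rw [hp]
    have : aeval (E.toAlgHom (AdjoinRoot.root f)) f = E.toAlgHom (aeval (AdjoinRoot.root f) f) :=
      aeval_algHom_apply _ _ _
    rw [AdjoinRoot.aeval_eq, AdjoinRoot.mk_self, map_zero] at this
    exact this
  have hder : ¬ g ∣ aeval p (derivative f) := by
    intro hd
    obtain ⟨a, b, hab⟩ := PerfectField.separable_of_irreducible hf
    have h1 := congrArg (aeval p) hab
    rw [map_add, map_mul, map_mul, map_one] at h1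
    exact hg.not_isUnit (isUnit_of_dvd_one (h1 ▸ dvd_add (hdvd.mul_left _) (hd.mul_left _)))
  obtain ⟨u, hu⟩ := hdvd
  have hcomp : ∀ q, f.comp q = aeval q f := fun q => rfl
  by_cases hgu : g ∣ u
  · obtain ⟨w, rfl⟩ := hgu
    obtain ⟨k, hk⟩ := (f.map (algebraMap K K[X])).binomExpansion p g
    simp only [Polynomial.eval_map_algebraMap, Polynomial.derivative_map] at hk
    refine ⟨p + g, aeval p (derivative f) + g * (w + k), ?_, ?_⟩
    · rw [hcomp, hk, hu]
      ring
    · refine (hg.isCoprime_or_dvd _).resolve_right fun hd => hder ?_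
      exact (dvd_add_left (dvd_mul_right _ _)).1 hd
  · exact ⟨p, u, (hcomp p).trans hu, (hg.isCoprime_or_dvd _).resolve_right hgu⟩

variable {V : Type*} [AddCommGroup V] [Module K V]

/-- Replacing `φ` by a suitable polynomial in `φ` changes the irreducible polynomial of a
primary endomorphism but not its partition. -/
theorem HasElementaryDivisors.aeval_of_comp_eq {φ : End K V} {f g p u : K[X]} (hf : f.Monic)
    (hfi : Irreducible f) (hg : g.Monic) (hgi : Irreducible g) (hfg : f.natDegree = g.natDegree)
    (hcomp : f.comp p = g * u) (hgu : IsCoprime g u) {l : Multiset ℕ}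
    (h : HasElementaryDivisors φ (l.map fun k => (g, k))) {N : ℕ} (hN : aeval φ (g ^ N) = 0) :
    HasElementaryDivisors (aeval φ p) (l.map fun k => (f, k)) := by
  have hcomp' : ∀ q : K[X], aeval (aeval φ p) q = aeval φ (q.comp p) := fun q => by
    rw [aeval_comp]
  intro q hq hqi j
  by_cases hqf : q = f
  · subst hqf
    rw [levelSum_map_prod q g, hfg, ← h g hg hgi j, hcomp', pow_comp, hcomp, mul_pow, mul_comm,
      map_mul, Module.End.mul_eq_comp, ker_comp_of_ker_eq_bot]
    exact ker_aeval_eq_bot_of_isCoprime (hgu.symm.pow (m := j) (n := N)) hN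
  · rw [levelSum_map_ne (Ne.symm hqf), mul_zero, ker_aeval_eq_bot_of_isCoprime (q := f ^ N),
      finrank_bot]
    · exact (isCoprime_of_monic_irreducible hq hf hqi hfi hqf).pow
    · rw [hcomp', pow_comp, hcomp, mul_pow, map_mul, hN, zero_mul]

end IrreducibleReplacement

section CycleTypes

/-- Pairs of a monic irreducible polynomial and a nonempty partition. -/
def IsCycleType {K : Type*} [Field K] (L : Multiset (K[X] × Multiset ℕ)) : Prop :=
  ∀ p ∈ L, p.1.Monic ∧ Irreducible p.1 ∧ p.2 ≠ 0 ∧ ∀ h ∈ p.2, 0 < h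

/-- The elementary divisors of a cycle type. -/
noncomputable def elementaryDivisors {K : Type*} [Field K] (L : Multiset (K[X] × Multiset ℕ)) :
    Multiset (K[X] × ℕ) :=
  (L.map fun p => p.2.map fun h => (p.1, h)).sum

/-- The class type of a cycle type. -/
noncomputable def classType {K : Type*} [Field K] (L : Multiset (K[X] × Multiset ℕ)) :
    Multiset (ℕ × Multiset ℕ) :=
  L.map fun p => (p.1.natDegree, p.2)

variable {K : Type*} [Field K]

theorem elementaryDivisors_cons (p : K[X] × Multiset ℕ) (L : Multiset (K[X] × Multiset ℕ)) :
    elementaryDivisors (p ::ₘ L) = (p.2.map fun h => (p.1, h)) + elementaryDivisors L := by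
  simp [elementaryDivisors]

theorem elementaryDivisors_add (L L' : Multiset (K[X] × Multiset ℕ)) :
    elementaryDivisors (L + L') = elementaryDivisors L + elementaryDivisors L' := by
  simp [elementaryDivisors]

theorem mem_elementaryDivisors {L : Multiset (K[X] × Multiset ℕ)} {x : K[X] × ℕ} :
    x ∈ elementaryDivisors L ↔ ∃ p ∈ L, p.1 = x.1 ∧ x.2 ∈ p.2 := by
  induction L using Multiset.induction_on with
  | empty => simp [elementaryDivisors]
  | cons a L ih =>
    rw [elementaryDivisors_cons, Multiset.mem_add, ih]
    obtain ⟨f, h⟩ := x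
    obtain ⟨g, l⟩ := a
    simp only [Multiset.mem_map, Prod.mk.injEq, Multiset.mem_cons, exists_eq_or_imp]
    exact or_congr_left ⟨fun ⟨k, hk, h1, h2⟩ => ⟨h1, h2 ▸ hk⟩, fun ⟨h1, h2⟩ => ⟨h, h2, h1, rfl⟩⟩

theorem IsCycleType.isElementary {L : Multiset (K[X] × Multiset ℕ)} (hL : IsCycleType L) :
    IsElementary (elementaryDivisors L) := by
  intro x hx
  obtain ⟨p, hp, hpx, hx2⟩ := mem_elementaryDivisors.1 hx
  obtain ⟨h1, h2, -, h4⟩ := hL p hp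
  exact hpx ▸ ⟨h1, h2, h4 _ hx2⟩

theorem IsCycleType.add {L L' : Multiset (K[X] × Multiset ℕ)} (hL : IsCycleType L)
    (hL' : IsCycleType L') : IsCycleType (L + L') := fun p hp =>
  (Multiset.mem_add.1 hp).elim (hL p) (hL' p)

theorem isCycleType_cons {p : K[X] × Multiset ℕ} {L : Multiset (K[X] × Multiset ℕ)} :
    IsCycleType (p ::ₘ L) ↔ (p.1.Monic ∧ Irreducible p.1 ∧ p.2 ≠ 0 ∧ ∀ h ∈ p.2, 0 < h) ∧
      IsCycleType L := by
  simp [IsCycleType]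

open Classical in
theorem eq_filter_elementaryDivisors {L : Multiset (K[X] × Multiset ℕ)}
    (hL : (L.map Prod.fst).Nodup) {p : K[X] × Multiset ℕ} (hp : p ∈ L) :
    p.2 = ((elementaryDivisors L).filter fun x => x.1 = p.1).map Prod.snd := by
  obtain ⟨L, rfl⟩ := Multiset.exists_cons_of_mem hp
  rw [Multiset.map_cons, Multiset.nodup_cons] at hL
  rw [elementaryDivisors_cons, Multiset.filter_add, Multiset.filter_eq_self.2,
    Multiset.filter_eq_nil.2]
  · simp
  · intro x hx hxp
    obtain ⟨q, hq, hqx, -⟩ := mem_elementaryDivisors.1 hx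
    exact hL.1 (Multiset.mem_map.2 ⟨q, hq, hqx.trans hxp⟩)
  · intro x hx
    obtain ⟨h, -, rfl⟩ := Multiset.mem_map.1 hx
    rfl

theorem subset_of_elementaryDivisors_eq {L L' : Multiset (K[X] × Multiset ℕ)}
    (hL : IsCycleType L) (hn : (L.map Prod.fst).Nodup)
    (hn' : (L'.map Prod.fst).Nodup) (h : elementaryDivisors L = elementaryDivisors L') :
    L ⊆ L' := by
  classical
  intro p hp
  obtain ⟨k, hk⟩ := Multiset.exists_mem_of_ne_zero (hL p hp).2.2.1
  have hmem : (p.1, k) ∈ elementaryDivisors L' := h ▸ mem_elementaryDivisors.2 ⟨p, hp, rfl, hk⟩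
  obtain ⟨q, hq, hqp, -⟩ := mem_elementaryDivisors.1 hmem
  have : p = q := by
    refine Prod.ext hqp.symm ?_
    rw [eq_filter_elementaryDivisors hn hp, eq_filter_elementaryDivisors hn' hq, h, hqp]
  exact this ▸ hq

theorem eq_of_elementaryDivisors_eq {L L' : Multiset (K[X] × Multiset ℕ)}
    (hL : IsCycleType L) (hL' : IsCycleType L') (hn : (L.map Prod.fst).Nodup)
    (hn' : (L'.map Prod.fst).Nodup) (h : elementaryDivisors L = elementaryDivisors L') :
    L = L' :=
  le_antisymm
    ((Multiset.le_iff_subset hn.of_map).2 (subset_of_elementaryDivisors_eq hL hn hn' h))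
    ((Multiset.le_iff_subset hn'.of_map).2 (subset_of_elementaryDivisors_eq hL' hn' hn h.symm))

theorem separation_classType {L L' : Multiset (K[X] × Multiset ℕ)} (hL : IsCycleType L)
    (hL' : IsCycleType L') (hn : (L.map Prod.fst).Nodup)
    (h : elementaryDivisors L = elementaryDivisors L') :
    Separation (classType L) (classType L') := by
  induction hc : L'.card using Nat.strong_induction_on generalizing L' with
  | _ N ih =>
    by_cases hn' : (L'.map Prod.fst).Nodup
    · rw [eq_of_elementaryDivisors_eq hL hL' hn hn' h]
      exact Relation.ReflTransGen.refl
    · rw [Multiset.nodup_iff_le] at hn'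
      push Not at hn'
      obtain ⟨f, hf⟩ := hn'
      obtain ⟨t, ht⟩ := Multiset.le_iff_exists_add.1 hf
      classical
      simp only [Multiset.cons_add, zero_add] at ht
      obtain ⟨⟨f₁, m⟩, hm, hm1, ht⟩ := (Multiset.map_eq_cons _ _ _ _).2 ht
      obtain ⟨⟨f₂, v⟩, hv, hv1, -⟩ := (Multiset.map_eq_cons _ _ _ _).2 ht
      simp only at hm1 hv1
      subst hm1 hv1
      obtain ⟨L₁, rfl⟩ := Multiset.exists_cons_of_mem hm
      rw [Multiset.erase_cons_head] at hv
      obtain ⟨L₀, rfl⟩ := Multiset.exists_cons_of_mem hv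
      rw [isCycleType_cons, isCycleType_cons] at hL'
      obtain ⟨⟨h1, h2, h3, h4⟩, ⟨-, -, h5, h6⟩, h7⟩ := hL'
      have hsep := ih (L₀.card + 1) (by simp at hc; omega) (L' := (f₂, m + v) ::ₘ L₀) ?_ ?_
        (by simp)
      · refine hsep.tail ⟨f₂.natDegree, m + v, m, v, classType L₀, ?_, h3, h5, rfl, ?_⟩ <;>
          simp [classType]
      · refine isCycleType_cons.2 ⟨⟨h1, h2, by simp [h3], fun k hk => ?_⟩, h7⟩
        exact (Multiset.mem_add.1 hk).elim (h4 k) (h6 k)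
      · rw [h]
        simp [elementaryDivisors_cons, add_assoc]

theorem Separation.exists_cycleType {T T' : Multiset (ℕ × Multiset ℕ)} (h : Separation T T')
    {L : Multiset (K[X] × Multiset ℕ)} (hL : IsCycleType L) (hT : classType L = T) :
    ∃ L', IsCycleType L' ∧ elementaryDivisors L' = elementaryDivisors L ∧ classType L' = T' := by
  classical
  induction h with
  | refl => exact ⟨L, hL, rfl, hT⟩
  | tail _ hstep ih =>
    obtain ⟨L', hL', hL'L, hL'T⟩ := ih
    obtain ⟨d, l, m, v, T₀, rfl, hm, hv, rfl, rfl⟩ := hstep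
    obtain ⟨⟨f, l⟩, hl, hfl, hT₀⟩ := (Multiset.map_eq_cons _ _ _ _).2 hL'T
    obtain ⟨L₀, rfl⟩ := Multiset.exists_cons_of_mem hl
    rw [Multiset.erase_cons_head] at hT₀
    simp only [Prod.mk.injEq] at hfl
    obtain ⟨rfl, rfl⟩ := hfl
    rw [isCycleType_cons] at hL'
    obtain ⟨⟨h1, h2, -, h4⟩, h5⟩ := hL'
    refine ⟨(f, m) ::ₘ (f, v) ::ₘ L₀, ?_, ?_, ?_⟩
    · rw [isCycleType_cons, isCycleType_cons]
      exact ⟨⟨h1, h2, hm, fun k hk => h4 k (Multiset.mem_add.2 (Or.inl hk))⟩,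
        ⟨h1, h2, hv, fun k hk => h4 k (Multiset.mem_add.2 (Or.inr hk))⟩, h5⟩
    · rw [← hL'L]
      simp [elementaryDivisors_cons, add_assoc]
    · simp [classType, ← hT₀]

theorem Multiset.exists_coe_eq_of_map_eq_coe {α β : Type*} (f : α → β) :
    ∀ (s : List β) (L : Multiset α), L.map f = s → ∃ l : List α, (l : Multiset α) = L ∧ l.map f = s
  | [], L, h => ⟨[], (Multiset.map_eq_zero.1 h).symm, rfl⟩
  | b :: s, L, h => by
    classical
    rw [← Multiset.cons_coe] at h
    obtain ⟨a, ha, rfl, h'⟩ := (Multiset.map_eq_cons _ _ _ _).2 h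
    obtain ⟨l, hl, rfl⟩ := Multiset.exists_coe_eq_of_map_eq_coe f s _ h'
    exact ⟨a :: l, by rw [← Multiset.cons_coe, hl, Multiset.cons_erase ha], rfl⟩

end CycleTypes

section CommutingEndomorphisms

open Module LinearMap

variable {K : Type*} [Field K]

theorem hasClassType_iff {n : ℕ} {M : Matrix (Fin n) (Fin n) K}
    {T : Multiset (ℕ × Multiset ℕ)} :
    HasClassType M T ↔ ∃ L : Multiset (K[X] × Multiset ℕ), IsCycleType L ∧
      (L.map Prod.fst).Nodup ∧ classType L = T ∧
      HasElementaryDivisors (toLin' M) (elementaryDivisors L) := by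
  constructor
  · rintro ⟨l, hn, hl, rfl, c, hc, hM⟩
    have hl' : IsCycleType (l : Multiset (K[X] × Multiset ℕ)) := hl
    have hcl : (c : Multiset (K[X] × ℕ)) = elementaryDivisors l := by
      rw [hc, elementaryDivisors, Multiset.map_coe, Multiset.sum_coe]
    refine ⟨l, hl', by simpa using hn, by simp [classType], ?_⟩
    rw [← hcl]
    exact hM.hasElementaryDivisors (hcl ▸ hl'.isElementary)
  · rintro ⟨L, hL, hn, rfl, hM⟩
    obtain ⟨l, rfl⟩ := Quot.exists_rep L
    obtain ⟨c, hc, hcM⟩ := exists_hasCycleTypeList M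
    refine ⟨l, by simpa using hn, hL, by simp [classType], c, ?_, hcM⟩
    rw [(hcM.hasElementaryDivisors hc).unique hM hc hL.isElementary]
    simp [elementaryDivisors]

variable {V : Type*} [AddCommGroup V] [Module K V]

theorem commute_aeval_of_commute {φ ψ : End K V} (h : Commute φ ψ) (p : K[X]) :
    Commute (aeval φ p) ψ :=
  LinearMap.ext fun v =>
    (aeval_intertwine ψ (fun w => (LinearMap.congr_fun h.eq w).symm) p v).symm

variable [FiniteDimensional K V]

theorem exists_conj_toLin' {n : ℕ} (hn : finrank K V = n) :
    ∃ (E : V ≃ₗ[K] (Fin n → K)) (m : End K V →* Matrix (Fin n) (Fin n) K),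
      ∀ (φ : End K V) v, E (φ v) = toLin' (m φ) (E v) := by
  set b := finBasisOfFinrankEq K V hn
  refine ⟨b.equivFun, MonoidHomClass.toMonoidHom (LinearMap.toMatrixAlgEquiv b),
    fun φ v => ?_⟩
  exact (LinearMap.toMatrix_mulVec_repr b b φ v).symm

theorem exists_hasElementaryDivisors (φ : End K V) :
    ∃ C, IsElementary C ∧ HasElementaryDivisors φ C ∧
      finrank K V = (C.map fun p => p.1.natDegree * p.2).sum := by
  obtain ⟨E, m, hm⟩ := exists_conj_toLin' (K := K) (V := V) rfl
  obtain ⟨c, hc, hcM⟩ := exists_hasCycleTypeList (m φ)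
  refine ⟨c, hc, (hcM.hasElementaryDivisors hc).conj E.symm fun v => ?_, hcM.card_eq⟩
  rw [LinearEquiv.symm_apply_eq, hm, LinearEquiv.apply_symm_apply]

theorem HasElementaryDivisors.finrank_eq {φ : End K V} {C : Multiset (K[X] × ℕ)}
    (h : HasElementaryDivisors φ C) (hC : IsElementary C) :
    finrank K V = (C.map fun p => p.1.natDegree * p.2).sum := by
  obtain ⟨D, hD, hφ, hdim⟩ := exists_hasElementaryDivisors φ
  rw [h.unique hφ hC hD, hdim]

theorem HasElementaryDivisors.exists_aeval_pow_eq_zero {φ : End K V} {f : K[X]} {l : Multiset ℕ}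
    (hf : f.Monic) (hfi : Irreducible f) (hl : ∀ k ∈ l, 0 < k)
    (h : HasElementaryDivisors φ (l.map fun k => (f, k))) : ∃ N, aeval φ (f ^ N) = 0 := by
  refine ⟨l.sum, ?_⟩
  rw [← ker_eq_top]
  apply Submodule.eq_top_of_finrank_eq
  rw [h f hf hfi, levelSum_eq_sum _ _ _ fun k hk => Multiset.le_sum_of_mem hk, h.finrank_eq]
  · rw [Multiset.map_map]
    exact (Multiset.map_id' l ▸ Multiset.sum_map_mul_left (s := l) (f := fun x => x)
      (a := f.natDegree)).symm
  · intro x hx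
    obtain ⟨k, hk, rfl⟩ := Multiset.mem_map.1 hx
    exact ⟨hf, hfi, hl k hk⟩

theorem typesCommute_of_endomorphisms {φ ψ : End K V} (hc : Commute φ ψ)
    {L L' : Multiset (K[X] × Multiset ℕ)} (hL : IsCycleType L) (hL' : IsCycleType L')
    (hn : (L.map Prod.fst).Nodup) (hn' : (L'.map Prod.fst).Nodup)
    (hφ : HasElementaryDivisors φ (elementaryDivisors L))
    (hψ : HasElementaryDivisors ψ (elementaryDivisors L')) {n : ℕ} (h : finrank K V = n) :
    TypesCommute K n (classType L) (classType L') := by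
  obtain ⟨E, m, hm⟩ := exists_conj_toLin' h
  exact ⟨m φ, m ψ, hasClassType_iff.2 ⟨L, hL, hn, rfl, hφ.conj E (hm φ)⟩,
    hasClassType_iff.2 ⟨L', hL', hn', rfl, hψ.conj E (hm ψ)⟩, hc.map m⟩

theorem exists_primary_hasElementaryDivisors [Nontrivial V] {φ : End K V} {f : K[X]}
    (hf : f.Monic) (hfi : Irreducible f) {N : ℕ} (hN : aeval φ (f ^ N) = 0) :
    ∃ l : Multiset ℕ, IsCycleType {(f, l)} ∧
      HasElementaryDivisors φ (elementaryDivisors {(f, l)}) := by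
  classical
  obtain ⟨C, hC, hφ, hdim⟩ := exists_hasElementaryDivisors φ
  have hfst : ∀ p ∈ C, p.1 = f := by
    intro p hp
    by_contra hne
    obtain ⟨h1, h2, h3⟩ := hC p hp
    have h4 := hφ p.1 h1 h2 1
    rw [pow_one, ker_aeval_eq_bot_of_isCoprime
      (isCoprime_of_monic_irreducible h1 hf h2 hfi hne).pow_right hN, finrank_bot] at h4
    obtain ⟨D, rfl⟩ := Multiset.exists_cons_of_mem hp
    have h5 := h2.natDegree_pos
    rw [levelSum_cons, if_pos rfl] at h4
    rcases Nat.mul_eq_zero.1 h4.symm with h6 | h6 <;> omega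
  have hCl : C = elementaryDivisors {(f, C.map Prod.snd)} := by
    simp only [elementaryDivisors, Multiset.map_singleton, Multiset.sum_singleton,
      Multiset.map_map, Function.comp_def]
    conv_lhs => rw [← Multiset.map_id C]
    exact Multiset.map_congr rfl fun p hp => Prod.ext (hfst p hp) rfl
  refine ⟨C.map Prod.snd, ?_, hCl ▸ hφ⟩
  intro p hp
  obtain rfl := Multiset.mem_singleton.1 hp
  refine ⟨hf, hfi, ?_, ?_⟩
  · intro h0
    rw [Multiset.map_eq_zero.1 h0] at hdim
    simp only [Multiset.map_zero, Multiset.sum_zero] at hdim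
    exact finrank_pos.ne' hdim
  · intro k hk
    obtain ⟨q, hq, rfl⟩ := Multiset.mem_map.1 hk
    exact (hC q hq).2.2

theorem exists_irreducible_ker_ne_bot [Nontrivial V] (φ : End K V) :
    ∃ f : K[X], f.Monic ∧ Irreducible f ∧ ker (aeval φ f) ≠ ⊥ := by
  obtain ⟨f, hf, hfi, r, hr⟩ := exists_monic_irreducible_factor (minpoly K φ)
    (minpoly.not_isUnit K φ)
  refine ⟨f, hf, hfi, fun hbot => ?_⟩
  have h0 : aeval φ r = 0 := by
    have := minpoly.aeval K φ
    rw [hr, map_mul] at this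
    ext v
    exact ker_eq_bot'.1 hbot _ (LinearMap.congr_fun this v)
  have hr0 : r ≠ 0 := by
    rintro rfl
    exact minpoly.ne_zero_of_finite K φ (by rw [hr, mul_zero])
  have h1 := natDegree_le_of_dvd (minpoly.dvd K φ h0) hr0
  rw [hr, natDegree_mul hf.ne_zero hr0] at h1
  have := hfi.natDegree_pos
  omega

/-- A pair of commuting endomorphisms is a direct sum of pairs of commuting primary
endomorphisms. -/
theorem exists_commuting_primary_decomposition : ∀ (n : ℕ) {V : Type*} [AddCommGroup V]
    [Module K V] [FiniteDimensional K V] {φ ψ : End K V}, Commute φ ψ → finrank K V = n →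
    ∃ D : Multiset ((K[X] × Multiset ℕ) × (K[X] × Multiset ℕ)),
      IsCycleType (D.map Prod.fst) ∧ IsCycleType (D.map Prod.snd) ∧
      HasElementaryDivisors φ (elementaryDivisors (D.map Prod.fst)) ∧
      HasElementaryDivisors ψ (elementaryDivisors (D.map Prod.snd)) ∧
      ∀ x ∈ D, PrimaryTypesCommute K (x.1.1.natDegree, x.1.2) (x.2.1.natDegree, x.2.2) := by
  intro n
  induction n using Nat.strong_induction_on with
  | _ n ih =>
    intro V _ _ _ φ ψ hc hn
    rcases subsingleton_or_nontrivial V with hV | hV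
    · refine ⟨0, by simp [IsCycleType], by simp [IsCycleType], ?_, ?_, by simp⟩ <;>
      · intro f _ _ j
        simp [elementaryDivisors, finrank_zero_of_subsingleton]
    have hsplit : ∀ θ : End K V, Commute θ φ → Commute θ ψ → ker θ ≠ ⊥ → (∀ N, θ ^ N ≠ 0) →
        ∃ D : Multiset ((K[X] × Multiset ℕ) × (K[X] × Multiset ℕ)),
          IsCycleType (D.map Prod.fst) ∧ IsCycleType (D.map Prod.snd) ∧
          HasElementaryDivisors φ (elementaryDivisors (D.map Prod.fst)) ∧
          HasElementaryDivisors ψ (elementaryDivisors (D.map Prod.snd)) ∧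
          ∀ x ∈ D, PrimaryTypesCommute K (x.1.1.natDegree, x.1.2) (x.2.1.natDegree, x.2.2) := by
      intro θ hθφ hθψ hker hnil
      obtain ⟨N, hN, hN0⟩ := (θ.eventually_isCompl_ker_pow_range_pow.and
        (Filter.eventually_ge_atTop 1)).exists
      have hmk : ∀ χ : End K V, Commute θ χ → ∀ v ∈ ker (θ ^ N), χ v ∈ ker (θ ^ N) := by
        intro χ hχ v hv
        rw [mem_ker, ← Module.End.mul_apply, (hχ.pow_left N).eq, Module.End.mul_apply,
          mem_ker.1 hv, map_zero]
      have hmr : ∀ χ : End K V, Commute θ χ → ∀ v ∈ range (θ ^ N), χ v ∈ range (θ ^ N) := by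
        rintro χ hχ _ ⟨w, rfl⟩
        refine ⟨χ w, ?_⟩
        rw [← Module.End.mul_apply, (hχ.pow_left N).eq, Module.End.mul_apply]
      have hsum := Submodule.finrank_add_eq_of_isCompl hN
      have hk1 : 0 < finrank K (ker (θ ^ N)) := by
        rw [Nat.pos_iff_ne_zero, Ne, Submodule.finrank_eq_zero]
        intro h0
        apply hker
        rw [eq_bot_iff, ← h0]
        intro v hv
        rw [mem_ker, ← Nat.sub_add_cancel hN0, pow_succ, Module.End.mul_apply, mem_ker.1 hv,
          map_zero]
      have hr1 : 0 < finrank K (range (θ ^ N)) := by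
        rw [Nat.pos_iff_ne_zero, Ne, Submodule.finrank_eq_zero, range_eq_bot]
        exact hnil N
      have hcomm : ∀ (W : Submodule K V) (h1 : ∀ v ∈ W, φ v ∈ W) (h2 : ∀ v ∈ W, ψ v ∈ W),
          Commute (φ.restrict h1 : End K W) (ψ.restrict h2) := by
        intro W h1 h2
        refine LinearMap.ext fun v => Subtype.ext ?_
        exact LinearMap.congr_fun hc.eq (v : V)
      obtain ⟨D, h1, h2, h3, h4, h5⟩ := ih _ (by omega)
        (hcomm _ (hmk φ hθφ) (hmk ψ hθψ)) rfl
      obtain ⟨D', h1', h2', h3', h4', h5'⟩ := ih _ (by omega)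
        (hcomm _ (hmr φ hθφ) (hmr ψ hθψ)) rfl
      refine ⟨D + D', ?_, ?_, ?_, ?_, ?_⟩
      · rw [Multiset.map_add]
        exact h1.add h1'
      · rw [Multiset.map_add]
        exact h2.add h2'
      · rw [Multiset.map_add, elementaryDivisors_add]
        refine (h3.prodMap h3').conj (Submodule.prodEquivOfIsCompl _ _ hN) fun v => ?_
        simp
      · rw [Multiset.map_add, elementaryDivisors_add]
        refine (h4.prodMap h4').conj (Submodule.prodEquivOfIsCompl _ _ hN) fun v => ?_
        simp
      · exact fun x hx => (Multiset.mem_add.1 hx).elim (h5 x) (h5' x)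
    obtain ⟨f, hf, hfi, hfk⟩ := exists_irreducible_ker_ne_bot φ
    obtain ⟨g, hg, hgi, hgk⟩ := exists_irreducible_ker_ne_bot ψ
    by_cases hfN : ∃ N, aeval φ (f ^ N) = 0
    · by_cases hgN : ∃ N, aeval ψ (g ^ N) = 0
      · obtain ⟨N, hN⟩ := hfN
        obtain ⟨N', hN'⟩ := hgN
        obtain ⟨l, hl, hlφ⟩ := exists_primary_hasElementaryDivisors hf hfi hN
        obtain ⟨l', hl', hlψ⟩ := exists_primary_hasElementaryDivisors hg hgi hN'
        refine ⟨{((f, l), (g, l'))}, hl, hl', hlφ, hlψ, ?_⟩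
        intro x hx
        obtain rfl := Multiset.mem_singleton.1 hx
        exact ⟨_, typesCommute_of_endomorphisms hc hl hl' (by simp) (by simp) hlφ hlψ rfl⟩
      · refine hsplit (aeval ψ g) ?_ ?_ hgk fun N h0 => hgN ⟨N, by rw [map_pow, h0]⟩
        · exact commute_aeval_of_commute hc.symm g
        · exact commute_aeval_of_commute (Commute.refl ψ) g
    · refine hsplit (aeval φ f) (commute_aeval_of_commute (Commute.refl φ) f)
        (commute_aeval_of_commute hc f) hfk fun N h0 => hfN ⟨N, by rw [map_pow, h0]⟩

theorem exists_commuting_primary_of_primaryTypesCommute [Finite K] {x y : K[X] × Multiset ℕ}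
    (hx : IsCycleType {x}) (hy : IsCycleType {y})
    (h : PrimaryTypesCommute K (x.1.natDegree, x.2) (y.1.natDegree, y.2)) :
    ∃ (m : ℕ) (φ ψ : End K (Fin m → K)), Commute φ ψ ∧
      HasElementaryDivisors φ (elementaryDivisors {x}) ∧
      HasElementaryDivisors ψ (elementaryDivisors {y}) := by
  have key : ∀ {m : ℕ} {M : Matrix (Fin m) (Fin m) K} {z : K[X] × Multiset ℕ},
      IsCycleType {z} → HasClassType M {(z.1.natDegree, z.2)} →
      ∃ p : K[X], HasElementaryDivisors (aeval (toLin' M) p) (elementaryDivisors {z}) := by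
    intro m M z hz hM
    obtain ⟨L, hL, -, hT, hLM⟩ := hasClassType_iff.1 hM
    obtain ⟨⟨g, l⟩, rfl, hgz⟩ := Multiset.map_eq_singleton.1 hT
    obtain ⟨f, l⟩ := z
    simp only [Prod.mk.injEq] at hgz
    obtain ⟨hdeg, rfl⟩ := hgz
    obtain ⟨hg, hgi, -, hl⟩ := hL (g, l) (Multiset.mem_singleton_self _)
    obtain ⟨hf, hfi, -, -⟩ := hz (f, l) (Multiset.mem_singleton_self _)
    obtain ⟨p, u, hpu, hu⟩ := exists_comp_eq_mul_of_natDegree_eq hfi hgi hdeg.symm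
    have he : ∀ q : K[X], elementaryDivisors {(q, l)} = l.map fun k => (q, k) := fun q => by
      simp [elementaryDivisors]
    rw [he] at hLM ⊢
    obtain ⟨N, hN⟩ := hLM.exists_aeval_pow_eq_zero hg hgi hl
    exact ⟨p, hLM.aeval_of_comp_eq hf hfi hg hgi hdeg.symm hpu hu hN⟩
  obtain ⟨m, X, Y, hX, hY, hXY⟩ := h
  obtain ⟨p, hp⟩ := key hx hX
  obtain ⟨q, hq⟩ := key hy hY
  refine ⟨m, aeval (toLin' X) p, aeval (toLin' Y) q, ?_, hp, hq⟩
  have : Commute (toLin' X) (toLin' Y) := hXY.map (toLinAlgEquiv' : _ ≃ₐ[K] _)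
  exact commute_aeval_of_commute (commute_aeval_of_commute this.symm q).symm p

theorem exists_commuting_of_forall₂ [Finite K] {l l' : List (K[X] × Multiset ℕ)}
    (h : List.Forall₂ (fun x y => PrimaryTypesCommute K (x.1.natDegree, x.2)
      (y.1.natDegree, y.2)) l l') :
    IsCycleType (l : Multiset (K[X] × Multiset ℕ)) →
    IsCycleType (l' : Multiset (K[X] × Multiset ℕ)) →
    ∃ (m : ℕ) (φ ψ : End K (Fin m → K)), Commute φ ψ ∧
      HasElementaryDivisors φ (elementaryDivisors l) ∧
      HasElementaryDivisors ψ (elementaryDivisors l') := by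
  induction h with
  | nil =>
    intro _ _
    refine ⟨0, 0, 0, Commute.refl _, ?_, ?_⟩ <;>
    · intro f _ _ j
      simp [elementaryDivisors, finrank_zero_of_subsingleton]
  | @cons x y l l' hxy _ ih =>
    intro hl hl'
    rw [← Multiset.cons_coe, isCycleType_cons] at hl hl'
    have hsing : ∀ z : K[X] × Multiset ℕ, (z.1.Monic ∧ Irreducible z.1 ∧ z.2 ≠ 0 ∧
        ∀ h ∈ z.2, 0 < h) → IsCycleType {z} := fun z hz p hp => by
      rwa [Multiset.mem_singleton.1 hp]
    obtain ⟨a, φ, ψ, hc, hφ, hψ⟩ :=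
      exists_commuting_primary_of_primaryTypesCommute (hsing _ hl.1) (hsing _ hl'.1) hxy
    obtain ⟨b, φ', ψ', hc', hφ', hψ'⟩ := ih hl.2 hl'.2
    obtain ⟨E, m, hm⟩ := exists_conj_toLin' (K := K) (V := (Fin a → K) × (Fin b → K)) rfl
    have hcp : Commute (LinearMap.prodMap φ φ' : End K ((Fin a → K) × (Fin b → K)))
        (LinearMap.prodMap ψ ψ') := by
      refine LinearMap.ext fun v => Prod.ext ?_ ?_
      · exact LinearMap.congr_fun hc.eq v.1
      · exact LinearMap.congr_fun hc'.eq v.2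
    refine ⟨_, toLin' (m (LinearMap.prodMap φ φ')), toLin' (m (LinearMap.prodMap ψ ψ')),
      (hcp.map m).map (toLinAlgEquiv' : _ ≃ₐ[K] _), ?_, ?_⟩
    · rw [← Multiset.cons_coe, ← Multiset.singleton_add, elementaryDivisors_add]
      exact (hφ.prodMap hφ').conj E (hm _)
    · rw [← Multiset.cons_coe, ← Multiset.singleton_add, elementaryDivisors_add]
      exact (hψ.prodMap hψ').conj E (hm _)

end CommutingEndomorphisms

/-- Let `S` and `T` be class types representable over the finite field `F_q`
(in dimension `n`).  Then `S` and `T` commute over `F_q` if and only if there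
exist a separation `S*` of `S` and a separation `T*` of `T` such that `S*` and
`T*` commute componentwise over `F_q`. -/
theorem stmt7 {K : Type*} [Field K] [Fintype K] {n : ℕ}
    (S T : Multiset (ℕ × Multiset ℕ))
    (hS : ∃ M : Matrix (Fin n) (Fin n) K, HasClassType M S)
    (hT : ∃ M : Matrix (Fin n) (Fin n) K, HasClassType M T) :
    TypesCommute K n S T ↔
      ∃ S' T' : Multiset (ℕ × Multiset ℕ),
        Separation S S' ∧ Separation T T' ∧ ComponentwiseCommute K S' T' := by
  constructor
  · rintro ⟨X, Y, hX, hY, hXY⟩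
    obtain ⟨L, hL, hn, rfl, hLX⟩ := hasClassType_iff.1 hX
    obtain ⟨L', hL', hn', rfl, hLY⟩ := hasClassType_iff.1 hY
    have hc : Commute (toLin' X) (toLin' Y) := hXY.map (toLinAlgEquiv' : _ ≃ₐ[K] _)
    obtain ⟨D, h1, h2, h3, h4, h5⟩ := exists_commuting_primary_decomposition _ hc rfl
    refine ⟨classType (D.map Prod.fst), classType (D.map Prod.snd),
      separation_classType hL h1 hn (hLX.unique h3 hL.isElementary h1.isElementary),
      separation_classType hL' h2 hn' (hLY.unique h4 hL'.isElementary h2.isElementary), ?_⟩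
    obtain ⟨d, rfl⟩ := Quot.exists_rep D
    refine ⟨d.map fun x => (x.1.1.natDegree, x.1.2), d.map fun x => (x.2.1.natDegree, x.2.2),
      by simp [classType, Function.comp_def],
      by simp [classType, Function.comp_def], by simp, fun i hs ht => ?_⟩
    simp only [List.get_eq_getElem, List.getElem_map]
    exact h5 _ (List.getElem_mem _)
  · rintro ⟨S', T', hSS', hTT', s, t, rfl, rfl, hlen, hst⟩
    obtain ⟨M, hM⟩ := hS
    obtain ⟨M', hM'⟩ := hT
    obtain ⟨L, hL, hn, rfl, hLM⟩ := hasClassType_iff.1 hM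
    obtain ⟨L', hL', hn', rfl, hLM'⟩ := hasClassType_iff.1 hM'
    obtain ⟨A, hA, hAL, hAs⟩ := hSS'.exists_cycleType hL rfl
    obtain ⟨B, hB, hBL, hBt⟩ := hTT'.exists_cycleType hL' rfl
    obtain ⟨a, rfl, rfl⟩ := Multiset.exists_coe_eq_of_map_eq_coe _ _ _ hAs
    obtain ⟨b, rfl, rfl⟩ := Multiset.exists_coe_eq_of_map_eq_coe _ _ _ hBt
    have hab := List.forall₂_iff_get.2 ⟨hlen, hst⟩
    rw [List.forall₂_map_left_iff, List.forall₂_map_right_iff] at hab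
    obtain ⟨m, φ, ψ, hc, hφ, hψ⟩ := exists_commuting_of_forall₂ hab hA hB
    rw [hAL] at hφ
    rw [hBL] at hψ
    refine typesCommute_of_endomorphisms hc hL hL' hn hn' hφ hψ ?_
    rw [hφ.finrank_eq hL.isElementary, ← hLM.finrank_eq hL.isElementary,
      Module.finrank_fin_fun]
end

section
/- Let M ∈ Mat_n(F_q) have part-size invariant k. Then the set of determinants of elements of the centralizer of M in Mat_n(F_q) is exactly the set of k-th powers in F_q. -/
open Polynomial Matrix

/-- The determinant is multiplicative along a short exact sequence of endomorphisms. -/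
lemma LinearMap.det_eq_mul_of_exact {K V W Q : Type*} [Field K] [AddCommGroup V] [Module K V]
    [FiniteDimensional K V] [AddCommGroup W] [Module K W] [AddCommGroup Q] [Module K Q]
    (i : W →ₗ[K] V) (q : V →ₗ[K] Q) (hi : Function.Injective i) (hq : Function.Surjective q)
    (hiq : LinearMap.range i = LinearMap.ker q)
    (w : W →ₗ[K] W) (v : V →ₗ[K] V) (u : Q →ₗ[K] Q)
    (hw : v ∘ₗ i = i ∘ₗ w) (hu : q ∘ₗ v = u ∘ₗ q) :
    LinearMap.det v = LinearMap.det w * LinearMap.det u := by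
  have hinv : LinearMap.ker q ≤ (LinearMap.ker q).comap v := fun x hx => by
    have : q (v x) = u (q x) := LinearMap.congr_fun hu x
    simp only [LinearMap.mem_ker] at hx
    simp [this, hx]
  rw [LinearMap.det_eq_det_mul_det (LinearMap.ker q) v hinv]
  congr 1
  · let e : W ≃ₗ[K] LinearMap.ker q :=
      (LinearEquiv.ofInjective i hi).trans (LinearEquiv.ofEq _ _ hiq)
    rw [← LinearMap.det_conj w e]
    congr 1
    ext x
    obtain ⟨y, rfl⟩ := e.surjective x
    have : v (i y) = i (w y) := LinearMap.congr_fun hw y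
    have he : ∀ z, (e z : V) = i z := fun z => rfl
    simp [he, this]
  · let e : (V ⧸ LinearMap.ker q) ≃ₗ[K] Q := q.quotKerEquivOfSurjective hq
    rw [← LinearMap.det_conj _ e]
    congr 1
    ext x
    obtain ⟨y, rfl⟩ := hq x
    have he : ∀ z : V, e (Submodule.Quotient.mk z) = q z := fun z => rfl
    have hs : e.symm (q y) = Submodule.Quotient.mk y := by rw [← he, e.symm_apply_apply]
    have : q (v y) = u (q y) := LinearMap.congr_fun hu y
    simp [hs, he, this]

lemma LinearMap.det_restrict_eq_mul {K V : Type*} [Field K] [AddCommGroup V] [Module K V]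
    [FiniteDimensional K V] {a N : V →ₗ[K] V} (haN : Commute a N) {p p₁ p₂ : Submodule K V}
    (h₁ : p₁ = p ⊓ LinearMap.ker N) (h₂ : p₂ = p.map N)
    (ha : ∀ x ∈ p, a x ∈ p) (ha₁ : ∀ x ∈ p₁, a x ∈ p₁) (ha₂ : ∀ x ∈ p₂, a x ∈ p₂) :
    LinearMap.det (a.restrict ha) =
      LinearMap.det (a.restrict ha₁) * LinearMap.det (a.restrict ha₂) := by
  have hle : p₁ ≤ p := h₁ ▸ inf_le_left
  have hN : ∀ x ∈ p, N x ∈ p₂ := fun x hx => h₂ ▸ Submodule.mem_map_of_mem hx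
  refine LinearMap.det_eq_mul_of_exact (Submodule.inclusion hle) (N.restrict hN)
    (Submodule.inclusion_injective hle) ?_ ?_ _ _ _ ?_ ?_
  · rintro ⟨y, hy⟩
    obtain ⟨x, hx, rfl⟩ := h₂ ▸ hy
    exact ⟨⟨x, hx⟩, rfl⟩
  · ext ⟨x, hx⟩
    simp [Submodule.range_inclusion, h₁, Subtype.ext_iff]
  · ext x
    rfl
  · ext x
    exact (LinearMap.congr_fun haN.eq x).symm

/-- The determinant of an endomorphism commuting with a nilpotent `N` is a `k`-th power as soon as
all the Jordan blocks of `N` have size divisible by `k`. The latter is expressed through the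
filtration `ker N ⊓ range (N ^ s)`, which may only jump at multiples of `k`. -/
lemma LinearMap.exists_pow_eq_det_of_commute {K V : Type*} [Field K] [AddCommGroup V] [Module K V]
    [FiniteDimensional K V] {a N : V →ₗ[K] V} (haN : Commute a N) (hN : IsNilpotent N) {k : ℕ}
    (hk : 0 < k)
    (H : ∀ s, ¬ k ∣ s + 1 → ∀ v, (N ^ (s + 1)) v = 0 → ∃ w, (N ^ s) v = (N ^ (s + 1)) w) :
    ∃ y : K, y ^ k = LinearMap.det a := by
  let R : ℕ → Submodule K V := fun s => LinearMap.range (N ^ s)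
  have hR : ∀ s, ∀ x ∈ R s, a x ∈ R s := by
    rintro s _ ⟨v, rfl⟩
    exact ⟨a v, (LinearMap.congr_fun (haN.pow_right s).eq v).symm⟩
  have hker : ∀ x ∈ LinearMap.ker N, a x ∈ LinearMap.ker N := fun x hx => by
    have := LinearMap.congr_fun haN.eq x
    simp only [LinearMap.mem_ker, Module.End.mul_apply] at hx this ⊢
    rw [← this, hx, map_zero]
  have hD : ∀ s, ∀ x ∈ R s ⊓ LinearMap.ker N, a x ∈ R s ⊓ LinearMap.ker N :=
    fun s x hx => ⟨hR s x hx.1, hker x hx.2⟩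
  let d : ℕ → K := fun s => LinearMap.det (a.restrict (hD s))
  let r : ℕ → K := fun s => LinearMap.det (a.restrict (hR s))
  have hr : ∀ s, r s = d s * r (s + 1) := fun s => by
    refine LinearMap.det_restrict_eq_mul haN rfl ?_ _ _ _
    simp only [R, pow_succ']
    exact LinearMap.range_comp _ _
  have hd : ∀ s, ¬ k ∣ s + 1 → d (s + 1) = d s := fun s hs => by
    have heq : R (s + 1) ⊓ LinearMap.ker N = R s ⊓ LinearMap.ker N := by
      apply le_antisymm
      · rintro _ ⟨⟨v, rfl⟩, hv⟩
        exact ⟨⟨N v, by rw [pow_succ]; rfl⟩, hv⟩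
      · rintro _ ⟨⟨v, rfl⟩, hv⟩
        refine ⟨?_, hv⟩
        obtain ⟨w, hw⟩ := H s hs v (by rw [pow_succ']; exact hv)
        exact ⟨w, hw.symm⟩
    have key : ∀ (p q : Submodule K V) (hp : ∀ x ∈ p, a x ∈ p) (hq : ∀ x ∈ q, a x ∈ q), p = q →
        LinearMap.det (a.restrict hp) = LinearMap.det (a.restrict hq) := by
      rintro p _ hp hq rfl
      rfl
    exact key _ _ _ _ heq
  have hdm : ∀ m j, j < k → d (k * m + j) = d (k * m) := fun m j => by
    induction j with
    | zero => simp
    | succ j ih =>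
      intro hj
      rw [← ih (by omega), ← add_assoc]
      refine hd _ fun hdvd => ?_
      rw [add_assoc, Nat.dvd_add_right (dvd_mul_right k m)] at hdvd
      exact absurd (Nat.le_of_dvd (by omega) hdvd) (by omega)
  have hrm : ∀ m j, j ≤ k → r (k * m) = d (k * m) ^ j * r (k * m + j) := fun m j => by
    induction j with
    | zero => simp
    | succ j ih =>
      intro hj
      rw [ih (by omega), hr (k * m + j), hdm m j (by omega)]
      ring_nf
  have hr0 : ∀ L, r 0 = (∏ m ∈ Finset.range L, d (k * m)) ^ k * r (k * L) := fun L => by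
    induction L with
    | zero => simp
    | succ L ih =>
      rw [ih, hrm L k le_rfl, Finset.prod_range_succ, mul_add_one]
      ring
  have hra : r 0 = LinearMap.det a := by
    have h0 : R 0 = ⊤ := by simp [R, Module.End.one_eq_id]
    let e : R 0 ≃ₗ[K] V := LinearEquiv.ofTop _ h0
    rw [← LinearMap.det_conj a e.symm]
    congr 1
  obtain ⟨L, hL⟩ := hN
  have hrL : r (k * L) = 1 := by
    have h0 : R (k * L) = ⊥ := by simp [R, mul_comm k, pow_mul, hL, zero_pow hk.ne']
    have : Subsingleton (R (k * L)) := by rw [h0]; infer_instance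
    exact LinearMap.det_eq_one_of_subsingleton _
  exact ⟨_, by rw [← hra, hr0 L, hrL, mul_one]⟩

/-- For a matrix whose minimal polynomial is a power `f ^ h` filling the whole space, `f` acts as a
single Jordan block of size `h`. -/
lemma Matrix.exists_aeval_pow_mulVec_eq {K m : Type*} [Field K] [Fintype m] [DecidableEq m]
    (B : Matrix m m K) {f : K[X]} {h : ℕ} (hf : Irreducible f)
    (hcard : Fintype.card m = f.natDegree * h)
    (hmin : minpoly K B = f ^ h) {s : ℕ} (hs : s + 1 ≠ h) (v : m → K)
    (hv : aeval B (f ^ (s + 1)) *ᵥ v = 0) :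
    ∃ w, aeval B (f ^ s) *ᵥ v = aeval B (f ^ (s + 1)) *ᵥ w := by
  classical
  have hzero : aeval B (f ^ h) = 0 := hmin ▸ minpoly.aeval K B
  rcases lt_or_gt_of_ne hs with hlt | hgt
  swap
  · refine ⟨0, ?_⟩
    rw [← Nat.add_sub_of_le (Nat.lt_succ_iff.mp hgt), pow_add, map_mul, hzero]
    simp
  obtain ⟨j, rfl⟩ : ∃ j, h = s + 1 + 1 + j := ⟨h - (s + 1 + 1), by omega⟩
  have hne : aeval B (f ^ (s + 1 + j)) ≠ 0 := fun h0 => by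
    have := minpoly.dvd K B h0
    rw [hmin, pow_dvd_pow_iff hf.ne_zero hf.not_isUnit] at this
    omega
  obtain ⟨w, hw⟩ : ∃ w, aeval B (f ^ (s + 1 + j)) *ᵥ w ≠ 0 := by
    by_contra! hcon
    refine hne (Matrix.ext_of_mulVec_single fun i => ?_)
    simp only [hcon, Matrix.zero_mulVec]
  have hann : ∀ g : K[X], aeval B g *ᵥ w = 0 → f ^ (s + 1 + 1 + j) ∣ g := fun g hg => by
    by_contra hnd
    let G := EuclideanDomain.gcd (f ^ (s + 1 + 1 + j)) g
    have hG : aeval B G *ᵥ w = 0 := by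
      simp only [G, EuclideanDomain.gcd_eq_gcd_ab]
      rw [mul_comm, mul_comm g, map_add, map_mul, map_mul, hzero, mul_zero, zero_add,
        ← Matrix.mulVec_mulVec, hg, Matrix.mulVec_zero]
    obtain ⟨i, hi, hassoc⟩ := (dvd_prime_pow hf.prime _).1
      (EuclideanDomain.gcd_dvd_left (f ^ (s + 1 + 1 + j)) g)
    have hle : i ≤ s + 1 + j := by
      by_contra hlt
      obtain rfl : i = s + 1 + 1 + j := by omega
      exact hnd (hassoc.symm.dvd.trans (EuclideanDomain.gcd_dvd_right _ _))
    obtain ⟨c, hc⟩ : G ∣ f ^ (s + 1 + j) := hassoc.dvd.trans (pow_dvd_pow _ hle)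
    rw [hc, mul_comm, map_mul, ← Matrix.mulVec_mulVec, hG, Matrix.mulVec_zero] at hw
    exact hw rfl
  let φ : degreeLT K (Fintype.card m) →ₗ[K] (m → K) :=
    { toFun := fun g => aeval B (g : K[X]) *ᵥ w
      map_add' := fun g g' => by simp [Matrix.add_mulVec]
      map_smul' := fun c g => by simp [Matrix.smul_mulVec] }
  have hφ : Function.Injective φ := by
    rw [← LinearMap.ker_eq_bot, LinearMap.ker_eq_bot']
    rintro ⟨g, hg⟩ h0
    have hdvd := hann g h0
    rw [mem_degreeLT, hcard] at hg
    have hdeg : (f ^ (s + 1 + 1 + j)).degree = (f.natDegree * (s + 1 + 1 + j) : ℕ) := by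
      rw [degree_eq_natDegree (pow_ne_zero _ hf.ne_zero), natDegree_pow, mul_comm]
    exact Subtype.ext (eq_zero_of_dvd_of_degree_lt hdvd (hdeg ▸ hg))
  have hsurj : Function.Surjective φ := by
    have e := degreeLTEquiv K (Fintype.card m)
    have : FiniteDimensional K (degreeLT K (Fintype.card m)) := e.symm.finiteDimensional
    refine (LinearMap.injective_iff_surjective_of_finrank_eq_finrank ?_).1 hφ
    simp [e.finrank_eq]
  obtain ⟨g, rfl⟩ := hsurj v
  change aeval B _ *ᵥ aeval B (g : K[X]) *ᵥ w = 0 at hv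
  rw [Matrix.mulVec_mulVec, ← map_mul] at hv
  obtain ⟨c, hc⟩ := hann _ hv
  refine ⟨aeval B (f ^ j * c) *ᵥ w, ?_⟩
  change aeval B _ *ᵥ aeval B (g : K[X]) *ᵥ w = _
  rw [Matrix.mulVec_mulVec, Matrix.mulVec_mulVec, ← map_mul, ← map_mul]
  congr 2
  have := pow_ne_zero (s + 1) hf.ne_zero
  apply mul_left_cancel₀ hf.ne_zero
  linear_combination hc

lemma Matrix.algebraMap_det_aeval {K L m : Type*} [Field K] [Field L] [Algebra K L] [Fintype m]
    [DecidableEq m] (A : Matrix m m K) (g : K[X]) :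
    algebraMap K L (aeval A g).det =
      (aeval (A.map (algebraMap K L)) (g.map (algebraMap K L))).det := by
  rw [RingHom.map_det, aeval_map_algebraMap]
  congr 1
  exact (aeval_algHom_apply (Algebra.ofId K L).mapMatrix A g).symm

/-- The determinant of `g(B)` depends only on `g` and the characteristic polynomial of `B`. -/
lemma Matrix.det_aeval_eq_pow_of_charpoly_eq {K m n : Type*} [Field K] [Fintype m] [DecidableEq m]
    [Fintype n] [DecidableEq n] (B : Matrix m m K) (C : Matrix n n K) {h : ℕ}
    (hBC : B.charpoly = C.charpoly ^ h) (g : K[X]) :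
    (aeval B g).det = (aeval C g).det ^ h := by
  have hcard : Fintype.card m = Fintype.card n * h := by
    have := congrArg natDegree hBC
    rwa [natDegree_pow, charpoly_natDegree_eq_dim, charpoly_natDegree_eq_dim, mul_comm] at this
  let L := AlgebraicClosure K
  let ι := algebraMap K L
  have key : ∀ t : L, (B.map ι - algebraMap L _ t).det = (C.map ι - algebraMap L _ t).det ^ h := by
    intro t
    have hL : (B.map ι).charpoly = (C.map ι).charpoly ^ h := by
      rw [charpoly_map, charpoly_map, hBC, Polynomial.map_pow]
    have := congrArg (eval t) hL
    rw [eval_pow, eval_charpoly, eval_charpoly, ← neg_sub, det_neg, ← neg_sub _ (scalar n t),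
      det_neg, mul_pow, hcard, pow_mul] at this
    exact mul_left_cancel₀ (pow_ne_zero _ (pow_ne_zero _ (by simp))) this
  have hsplit : ∀ (c : L) (S : Multiset L),
      (aeval (B.map ι) (Polynomial.C c * (S.map fun a => X - Polynomial.C a).prod)).det =
        (aeval (C.map ι) (Polynomial.C c * (S.map fun a => X - Polynomial.C a).prod)).det ^ h := by
    intro c S
    induction S using Multiset.induction with
    | empty =>
      simp [Matrix.algebraMap_eq_diagonal, hcard, pow_mul]
    | cons a S ih =>
      rw [Multiset.map_cons, Multiset.prod_cons, mul_left_comm, map_mul, det_mul, ih,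
        map_mul _ (X - Polynomial.C a), det_mul, mul_pow]
      simp [key]
  apply ι.injective
  have hg := (IsAlgClosed.splits (g.map ι)).eq_prod_roots
  have := hsplit (g.map ι).leadingCoeff (g.map ι).roots
  rw [← hg] at this
  rw [map_pow, algebraMap_det_aeval, algebraMap_det_aeval, this]

lemma Matrix.exists_det_aeval_eq_pow {K m : Type*} [Field K] [Finite K] [Fintype m] [DecidableEq m]
    (B : Matrix m m K) {f : K[X]} {h : ℕ} (hm : f.Monic) (hf : Irreducible f)
    (hB : B.charpoly = f ^ h) (y : K) : ∃ g : K[X], (aeval B g).det = y ^ h := by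
  have := Fact.mk hf
  let pb := AdjoinRoot.powerBasis hf.ne_zero
  have : Module.Finite K (AdjoinRoot f) := pb.finite
  have : Finite (AdjoinRoot f) := Module.finite_of_finite K
  obtain ⟨x, hx⟩ := FiniteField.norm_surjective K (AdjoinRoot f) y
  obtain ⟨g, rfl⟩ := AdjoinRoot.mk_surjective x
  refine ⟨g, ?_⟩
  rw [Matrix.det_aeval_eq_pow_of_charpoly_eq B (Algebra.leftMulMatrix pb.basis pb.gen), ← hx,
    Algebra.norm_eq_matrix_det pb.basis]
  · rw [← AdjoinRoot.aeval_eq, ← aeval_algHom_apply]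
    rfl
  · rw [charpoly_leftMulMatrix, hB, AdjoinRoot.powerBasis_gen, AdjoinRoot.minpoly_root hf.ne_zero,
      hm.leadingCoeff, inv_one, map_one, mul_one]

lemma Matrix.det_blockDiagonal'_fin {K : Type*} [CommRing K] {l : ℕ} {m : Fin l → Type*}
    [∀ i, Fintype (m i)] [∀ i, DecidableEq (m i)] (B : ∀ i, Matrix (m i) (m i) K) :
    (blockDiagonal' B).det = ∏ i, (B i).det := by
  rw [(blockTriangular_blockDiagonal' B).det_fintype]
  refine Finset.prod_congr rfl fun i _ => ?_
  let e : m i ≃ {a : Σ i, m i // a.1 = i} :=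
    { toFun := fun x => ⟨⟨i, x⟩, rfl⟩
      invFun := fun a => a.2 ▸ a.1.2
      left_inv := fun x => rfl
      right_inv := by rintro ⟨⟨_, x⟩, rfl⟩; rfl }
  rw [← det_submatrix_equiv_self e]
  congr 1
  ext x y
  simp [e, toSquareBlock_def]

/-- Bézout's identity, written multiplicatively. -/
lemma Finset.exists_prod_pow_eq_pow_gcd {G ι : Type*} [CommGroup G] (s : Finset ι) (h : ι → ℕ)
    (y : G) : ∃ z : ι → G, ∏ i ∈ s, z i ^ h i = y ^ s.gcd h := by
  classical
  induction s using Finset.induction_on with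
  | empty => exact ⟨1, by simp⟩
  | insert a s ha ih =>
    obtain ⟨z, hz⟩ := ih
    refine ⟨fun i => if i = a then y ^ (h a).gcdA (s.gcd h) else z i ^ (h a).gcdB (s.gcd h), ?_⟩
    rw [Finset.prod_insert ha, Finset.gcd_insert]
    beta_reduce
    rw [if_pos rfl]
    have : ∀ i ∈ s, (if i = a then y ^ (h a).gcdA (s.gcd h)
        else z i ^ (h a).gcdB (s.gcd h)) ^ h i = (z i ^ h i) ^ (h a).gcdB (s.gcd h) := by
      intro i hi
      rw [if_neg (ne_of_mem_of_not_mem hi ha), ← zpow_natCast, ← zpow_natCast, ← _root_.zpow_mul,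
        ← _root_.zpow_mul, mul_comm]
    rw [Finset.prod_congr rfl this, Finset.prod_zpow, hz, ← zpow_natCast, ← zpow_natCast,
      ← zpow_natCast, ← _root_.zpow_mul, ← _root_.zpow_mul, ← _root_.zpow_add]
    congr 1
    change _ = ((Nat.gcd _ _ : ℕ) : ℤ)
    rw [Nat.gcd_eq_gcd_ab]
    ring

lemma Matrix.aeval_blockDiagonal' {K o : Type*} [Field K] [Fintype o] [DecidableEq o]
    {m : o → Type*} [∀ i, Fintype (m i)] [∀ i, DecidableEq (m i)] (B : ∀ i, Matrix (m i) (m i) K)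
    (F : K[X]) : aeval (blockDiagonal' B) F = blockDiagonal' fun i => aeval (B i) F := by
  let φ : (∀ i, Matrix (m i) (m i) K) →ₐ[K] Matrix (Σ i, m i) (Σ i, m i) K :=
    { blockDiagonal'RingHom m K with
      commutes' := fun r => by
        change blockDiagonal' (algebraMap K (∀ i, Matrix (m i) (m i) K) r) = _
        rw [Algebra.algebraMap_eq_smul_one, Algebra.algebraMap_eq_smul_one, blockDiagonal'_smul,
          blockDiagonal'_one] }
  change _ = φ fun i => aeval (B i) F
  refine (aeval_algHom_apply φ B F).trans ?_
  congr 1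
  ext1 i
  exact (aeval_algHom_apply (Pi.evalAlgHom K _ i) B F).symm

lemma Matrix.blockDiagonal'_mulVec_apply {R o : Type*} [Semiring R] [Fintype o] [DecidableEq o]
    {m : o → Type*} [∀ i, Fintype (m i)] (B : ∀ i, Matrix (m i) (m i) R) (v : (Σ i, m i) → R)
    (i : o) (j : m i) : (blockDiagonal' B *ᵥ v) ⟨i, j⟩ = (B i *ᵥ fun j => v ⟨i, j⟩) j := by
  simp only [mulVec, dotProduct, Fintype.sum_sigma]
  rw [Finset.sum_eq_single i]
  · simp
  · intro i' _ hne
    simp [blockDiagonal'_apply_ne _ _ _ hne.symm]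
  · simp

lemma Matrix.exists_aeval_mul_pow_mulVec_eq {K m : Type*} [Field K] [Fintype m] [DecidableEq m]
    (B : Matrix m m K) {f u : K[X]} {h : ℕ} (hf : Irreducible f)
    (hcard : Fintype.card m = f.natDegree * h) (hmin : minpoly K B = f ^ h) (hu : IsCoprime u f)
    {s : ℕ} (hs : s + 1 ≠ h) (v : m → K) (hv : aeval B ((f * u) ^ (s + 1)) *ᵥ v = 0) :
    ∃ w, aeval B ((f * u) ^ s) *ᵥ v = aeval B ((f * u) ^ (s + 1)) *ᵥ w := by
  have hzero : aeval B (f ^ h) = 0 := hmin ▸ minpoly.aeval K B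
  obtain ⟨a, b, hab⟩ := hu.pow_right (n := h)
  have hinv : aeval B a * aeval B u = 1 := by
    have := congrArg (aeval B) hab
    rwa [map_add, map_mul, map_mul, hzero, mul_zero, add_zero, map_one] at this
  have hinv_pow : aeval B (a ^ (s + 1) * u ^ (s + 1)) = 1 := by
    rw [← mul_pow, map_pow, map_mul, hinv, one_pow]
  have hv' : aeval B (f ^ (s + 1)) *ᵥ v = 0 := by
    have := congrArg (aeval B (a ^ (s + 1)) *ᵥ ·) hv
    simp only [mulVec_mulVec, mulVec_zero] at this
    rwa [← map_mul, mul_pow, mul_comm (f ^ _), ← mul_assoc, map_mul, hinv_pow, one_mul] at this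
  obtain ⟨w, hw⟩ := B.exists_aeval_pow_mulVec_eq hf hcard hmin hs v hv'
  refine ⟨aeval B a *ᵥ w, ?_⟩
  have h₁ : (f * u) ^ (s + 1) * a = u ^ s * f ^ (s + 1) * (a * u) := by ring
  rw [mulVec_mulVec, ← map_mul, h₁, map_mul, map_mul _ a, hinv, mul_one, mul_pow, mul_comm,
    map_mul, ← mulVec_mulVec, hw, mulVec_mulVec, ← map_mul]

lemma Matrix.exists_pow_eq_det_of_commute_blockDiagonal' {K o : Type*} [Field K] [Fintype o]
    [DecidableEq o] {m : o → Type*} [∀ i, Fintype (m i)] [∀ i, DecidableEq (m i)]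
    (B : ∀ i, Matrix (m i) (m i) K) (f : o → K[X]) (h : o → ℕ) (hm : ∀ i, (f i).Monic)
    (hf : ∀ i, Irreducible (f i)) (hcard : ∀ i, Fintype.card (m i) = (f i).natDegree * h i)
    (hmin : ∀ i, minpoly K (B i) = f i ^ h i) {k : ℕ} (hk : 0 < k) (hkh : ∀ i, k ∣ h i)
    {A : Matrix (Σ i, m i) (Σ i, m i) K} (hA : Commute A (blockDiagonal' B)) :
    ∃ y : K, y ^ k = A.det := by
  classical
  let F : K[X] := ∏ p ∈ Finset.univ.image f, p
  have hF : ∀ i, ∃ u, F = f i * u ∧ IsCoprime u (f i) := fun i => by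
    refine ⟨_, (Finset.mul_prod_erase _ _ (Finset.mem_image_of_mem f (Finset.mem_univ i))).symm, ?_⟩
    refine IsCoprime.prod_left fun p hp => ?_
    obtain ⟨hne, hp⟩ := Finset.mem_erase.1 hp
    obtain ⟨j, -, rfl⟩ := Finset.mem_image.1 hp
    refine ((hf j).coprime_iff_not_dvd).2 fun hdvd => hne ?_
    exact eq_of_monic_of_associated (hm j) (hm i)
      ((hf j).associated_of_dvd (hf i) hdvd)
  let N := aeval (blockDiagonal' B) F
  have hpow : ∀ s, N ^ s = blockDiagonal' fun i => aeval (B i) (F ^ s) := fun s => by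
    rw [← aeval_blockDiagonal', map_pow]
  have hAN : Commute A N := by
    have : N ∈ Algebra.adjoin K {blockDiagonal' B} := aeval_mem_adjoin_singleton K _
    exact Algebra.commute_of_mem_adjoin_singleton_of_commute this hA
  have hnil : IsNilpotent N := by
    refine ⟨∑ i, h i, ?_⟩
    rw [hpow, ← blockDiagonal'_zero]
    congr 1
    ext1 i
    obtain ⟨u, hu, -⟩ := hF i
    have hdvd : f i ^ h i ∣ F ^ ∑ i, h i :=
      (pow_dvd_pow _ (Finset.single_le_sum (fun _ _ => Nat.zero_le _) (Finset.mem_univ i))).trans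
        (pow_dvd_pow_of_dvd ⟨u, hu⟩ _)
    exact (minpoly.dvd_iff).1 (hmin i ▸ hdvd)
  rw [← LinearMap.det_toLin']
  refine LinearMap.exists_pow_eq_det_of_commute (N := toLin' N) ?_ ?_ hk ?_
  · exact hAN.map (toLinAlgEquiv' (R := K))
  · exact hnil.map (toLinAlgEquiv' (R := K))
  intro s hs v hv
  simp only [← toLin'_pow, toLin'_apply, hpow] at hv ⊢
  have hblock : ∀ i, ∃ w, aeval (B i) (F ^ s) *ᵥ (fun j => v ⟨i, j⟩) =
      aeval (B i) (F ^ (s + 1)) *ᵥ w := fun i => by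
    obtain ⟨u, hu, hcop⟩ := hF i
    have hvi : aeval (B i) (F ^ (s + 1)) *ᵥ (fun j => v ⟨i, j⟩) = 0 := by
      ext j
      rw [← blockDiagonal'_mulVec_apply (fun i => aeval (B i) (F ^ (s + 1))), hv]
      rfl
    rw [hu] at hvi ⊢
    exact (B i).exists_aeval_mul_pow_mulVec_eq (hf i) (hcard i) (hmin i) hcop
      (fun h => hs (h ▸ hkh i)) _ hvi
  choose w hw using hblock
  refine ⟨fun x => w x.1 x.2, ?_⟩
  ext ⟨i, j⟩
  rw [blockDiagonal'_mulVec_apply, blockDiagonal'_mulVec_apply, hw]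

lemma Matrix.exists_commute_blockDiagonal'_det_eq_pow {K : Type*} [Field K] [Finite K] {l : ℕ}
    {m : Fin l → Type*} [∀ i, Fintype (m i)] [∀ i, DecidableEq (m i)]
    (B : ∀ i, Matrix (m i) (m i) K) (f : Fin l → K[X]) (h : Fin l → ℕ) (hm : ∀ i, (f i).Monic)
    (hf : ∀ i, Irreducible (f i)) (hpos : ∀ i, 0 < h i)
    (hB : ∀ i, (B i).charpoly = f i ^ h i) (y : K) :
    ∃ A, Commute A (blockDiagonal' B) ∧ A.det = y ^ Finset.univ.gcd h := by
  obtain ⟨z, hz⟩ : ∃ z : Fin l → K, ∏ i, z i ^ h i = y ^ Finset.univ.gcd h := by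
    rcases isEmpty_or_nonempty (Fin l) with hl | ⟨⟨i⟩⟩
    · exact ⟨0, by simp⟩
    rcases eq_or_ne y 0 with rfl | hy
    · have hk : Finset.univ.gcd h ≠ 0 := fun h0 =>
        (hpos i).ne' (Finset.gcd_eq_zero_iff.1 h0 i (Finset.mem_univ i))
      refine ⟨0, ?_⟩
      rw [zero_pow hk]
      exact Finset.prod_eq_zero (Finset.mem_univ i) (zero_pow (hpos i).ne')
    · obtain ⟨z, hz⟩ := Finset.exists_prod_pow_eq_pow_gcd Finset.univ h (Units.mk0 y hy)
      exact ⟨fun i => z i, by simpa using congrArg Units.val hz⟩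
  choose g hg using fun i => (B i).exists_det_aeval_eq_pow (hm i) (hf i) (hB i) (z i)
  refine ⟨blockDiagonal' fun i => aeval (B i) (g i), ?_, ?_⟩
  · rw [commute_iff_eq, ← blockDiagonal'_mul, ← blockDiagonal'_mul]
    congr 1
    ext1 i
    simpa using congrArg (aeval (B i)) (mul_comm (g i) X)
  · rw [det_blockDiagonal'_fin, ← hz]
    exact Finset.prod_congr rfl fun i _ => hg i

lemma SimilarMat.exists_commute_det_eq {m : Type*} [Fintype m] [DecidableEq m] {K : Type*}
    [CommRing K] {A B : Matrix m m K} (hAB : SimilarMat A B) {δ : K}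
    (h : ∃ C, Commute C A ∧ C.det = δ) : ∃ C, Commute C B ∧ C.det = δ := by
  obtain ⟨P, rfl⟩ := hAB
  obtain ⟨C, hC, rfl⟩ := h
  refine ⟨P * C * (P⁻¹ : (Matrix m m K)ˣ), ?_, Matrix.det_units_conj P C⟩
  rw [commute_iff_eq]
  simp only [mul_assoc, Units.inv_mul_cancel_left]
  rw [hC.left_comm]

lemma SimilarMat.symm {m : Type*} [Fintype m] [DecidableEq m] {K : Type*} [CommRing K]
    {A B : Matrix m m K} (hAB : SimilarMat A B) : SimilarMat B A := by
  obtain ⟨P, rfl⟩ := hAB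
  exact ⟨P⁻¹, by simp [mul_assoc]⟩

lemma Matrix.exists_commute_reindex_det_eq_iff {m n : Type*} [Fintype m] [DecidableEq m]
    [Fintype n] [DecidableEq n] {K : Type*} [CommRing K] (e : m ≃ n) (A : Matrix m m K) (δ : K) :
    (∃ C, Commute C (reindex e e A) ∧ C.det = δ) ↔ ∃ C, Commute C A ∧ C.det = δ := by
  rw [← (reindex e e).exists_congr_right]
  refine exists_congr fun C => ?_
  rw [det_reindex_self]
  refine and_congr_left fun _ => ?_
  let φ := reindexAlgEquiv K K e
  exact ⟨fun h => Commute.of_map φ.injective h, fun h => h.map φ⟩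

/-- Let `M ∈ Mat_n(F_q)` have class type `T` and part-size invariant `k` (the
gcd of all the parts of all the partitions occurring in `T`).  Then the set of
determinants of elements of the centralizer of `M` in `Mat_n(F_q)` is exactly
the set of `k`-th powers in `F_q`. -/
theorem stmt9 {K : Type*} [Field K] [Fintype K] {n : ℕ}
    (M : Matrix (Fin n) (Fin n) K) (T : Multiset (ℕ × Multiset ℕ))
    (hT : HasClassType M T) (k : ℕ)
    (hk : k = ((T.map Prod.snd).sum).gcd) :
    {δ : K | ∃ A : Matrix (Fin n) (Fin n) K, Commute A M ∧ A.det = δ} =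
      {x : K | ∃ y : K, y ^ k = x} := by
  obtain ⟨l, -, hl, rfl, c, hc, B, hB, e, hM⟩ := hT
  have hc' : (c : Multiset (K[X] × ℕ)) =
      (l : Multiset (K[X] × Multiset ℕ)).bind fun p => p.2.map fun h => (p.1, h) := by
    rw [hc, Multiset.bind, Multiset.map_coe, Multiset.join, Multiset.sum_coe]
  have hmem : ∀ i : Fin c.length,
      (c.get i).1.Monic ∧ Irreducible (c.get i).1 ∧ 0 < (c.get i).2 := fun i => by
    have hi : c.get i ∈ (c : Multiset (K[X] × ℕ)) := Multiset.mem_coe.2 (c.get_mem i)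
    rw [hc', Multiset.mem_bind] at hi
    obtain ⟨p, hp, hi⟩ := hi
    obtain ⟨h, hh, hi⟩ := Multiset.mem_map.1 hi
    obtain ⟨h₁, h₂, -, h₃⟩ := hl p hp
    rw [← hi]
    exact ⟨h₁, h₂, h₃ h hh⟩
  have hk' : k = Finset.univ.gcd fun i : Fin c.length => (c.get i).2 := by
    have hparts : (c : Multiset (K[X] × ℕ)).map Prod.snd = (l.map Prod.snd).sum := by
      rw [hc', Multiset.map_bind]
      simp [Multiset.bind, Multiset.join]
    have hget : Finset.univ.val.map (fun i : Fin c.length => (c.get i).2) =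
        (c : Multiset (K[X] × ℕ)).map Prod.snd := by
      rw [Fin.univ_val_map, Multiset.map_coe]
      congr 1
      conv_rhs => rw [← List.ofFn_get c, List.map_ofFn]
      rfl
    rw [Finset.gcd_def, hget, hparts, hk]
    simp [Function.comp_def]
  have hiff : ∀ δ : K, (∃ A, Commute A M ∧ A.det = δ) ↔
      ∃ A, Commute A (blockDiagonal' B) ∧ A.det = δ := fun δ => by
    rw [← exists_commute_reindex_det_eq_iff e]
    exact ⟨hM.symm.exists_commute_det_eq, hM.exists_commute_det_eq⟩
  ext δ
  rw [Set.mem_ofPred_eq, Set.mem_ofPred_eq, hiff]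
  constructor
  · rintro ⟨A, hA, rfl⟩
    rcases Nat.eq_zero_or_pos k with rfl | hpos
    · have : IsEmpty (Fin c.length) := ⟨fun i => (hmem i).2.2.ne'
        (Finset.gcd_eq_zero_iff.1 hk'.symm i (Finset.mem_univ i))⟩
      exact ⟨1, by rw [det_isEmpty, pow_zero]⟩
    · exact exists_pow_eq_det_of_commute_blockDiagonal' B (fun i => (c.get i).1)
        (fun i => (c.get i).2) (fun i => (hmem i).1) (fun i => (hmem i).2.1)
        (fun i => Fintype.card_fin _) (fun i => (hB i).2) hpos
        (fun i => hk' ▸ Finset.gcd_dvd (Finset.mem_univ i)) hA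
  · rintro ⟨y, rfl⟩
    rw [hk']
    exact exists_commute_blockDiagonal'_det_eq_pow B (fun i => (c.get i).1)
      (fun i => (c.get i).2) (fun i => (hmem i).1) (fun i => (hmem i).2.1)
      (fun i => (hmem i).2.2) (fun i => (hB i).1) y
end

section
/- Let M be a nilpotent n×n matrix over F_q whose Jordan partition has part-size invariant k (the gcd of its parts). Then the determinant of every element of the centralizer of M in Mat_n(F_q) is a k-th power in F_q. -/
open Polynomial Matrix

/-- The nilpotent Jordan block of size `p` (eigenvalue `0`). -/
def jordanBlock (K : Type*) [Zero K] [One K] (p : ℕ) : Matrix (Fin p) (Fin p) K :=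
  Matrix.of fun i j => if (i : ℕ) + 1 = (j : ℕ) then 1 else 0

/-- `M` is a nilpotent matrix whose Jordan block sizes are the parts of the
partition `mu`; that is, `M` is similar to the direct sum of the nilpotent
Jordan blocks whose sizes are the parts of `mu`. -/
def HasJordanPartition {K : Type*} [Field K] {n : ℕ}
    (M : Matrix (Fin n) (Fin n) K) (mu : Nat.Partition n) : Prop :=
  ∃ L : List ℕ, (↑L : Multiset ℕ) = mu.parts ∧
    ∃ e : ((i : Fin L.length) × Fin (L.get i)) ≃ Fin n,
      SimilarMat (Matrix.reindex e e (Matrix.blockDiagonal' fun i => jordanBlock K (L.get i))) M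

section JordanCentralizer

variable {K : Type*} [CommRing K] {ι : Type*} [Fintype ι] [DecidableEq ι] {s : ι → ℕ}

theorem blockDiagonal_jordanBlock_mul_apply (A : Matrix (Σ i, Fin (s i)) (Σ i, Fin (s i)) K)
    (i : ι) (a : Fin (s i)) (y : Σ i, Fin (s i)) :
    (blockDiagonal' (fun i => jordanBlock K (s i)) * A) ⟨i, a⟩ y =
      if h : (a : ℕ) + 1 < s i then A ⟨i, ⟨a + 1, h⟩⟩ y else 0 := by
  rw [Matrix.mul_apply, Fintype.sum_sigma, Finset.sum_eq_single i]
  · simp only [blockDiagonal'_apply_eq, jordanBlock, of_apply]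
    split_ifs with h
    · rw [Finset.sum_eq_single ⟨a + 1, h⟩]
      · simp
      · intro b _ hb
        rw [if_neg (fun hab => hb (Fin.ext hab.symm)), zero_mul]
      · simp
    · refine Finset.sum_eq_zero fun b _ => ?_
      rw [if_neg (by omega), zero_mul]
  · intro j _ hj
    refine Finset.sum_eq_zero fun b _ => ?_
    rw [blockDiagonal'_apply_ne _ _ _ hj.symm, zero_mul]
  · simp

theorem mul_blockDiagonal_jordanBlock_apply_zero
    (A : Matrix (Σ i, Fin (s i)) (Σ i, Fin (s i)) K)
    (x : Σ i, Fin (s i)) (j : ι) (h : 0 < s j) :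
    (A * blockDiagonal' (fun i => jordanBlock K (s i))) x ⟨j, ⟨0, h⟩⟩ = 0 := by
  rw [Matrix.mul_apply, Fintype.sum_sigma]
  refine Finset.sum_eq_zero fun i _ => Finset.sum_eq_zero fun b _ => ?_
  by_cases hij : i = j
  · subst hij
    simp [jordanBlock]
  · rw [blockDiagonal'_apply_ne _ _ _ hij, mul_zero]

theorem mul_blockDiagonal_jordanBlock_apply_succ
    (A : Matrix (Σ i, Fin (s i)) (Σ i, Fin (s i)) K)
    (x : Σ i, Fin (s i)) (j : ι) (b : ℕ) (h : b + 1 < s j) :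
    (A * blockDiagonal' (fun i => jordanBlock K (s i))) x ⟨j, ⟨b + 1, h⟩⟩ =
      A x ⟨j, ⟨b, by omega⟩⟩ := by
  rw [Matrix.mul_apply, Fintype.sum_sigma, Finset.sum_eq_single j]
  · rw [Finset.sum_eq_single ⟨b, by omega⟩]
    · simp [jordanBlock]
    · intro c _ hc
      have : ¬ (c : ℕ) = b := fun hcb => hc (Fin.ext hcb)
      simp [jordanBlock, this]
    · simp
  · intro i _ hi
    refine Finset.sum_eq_zero fun c _ => ?_
    rw [blockDiagonal'_apply_ne _ _ _ hi, mul_zero]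
  · simp

variable {A : Matrix (Σ i, Fin (s i)) (Σ i, Fin (s i)) K}

theorem apply_succ_succ_of_commute
    (hA : Commute A (blockDiagonal' fun i => jordanBlock K (s i)))
    (i j : ι) (a b : ℕ) (ha : a + 1 < s i) (hb : b + 1 < s j) :
    A ⟨i, ⟨a + 1, ha⟩⟩ ⟨j, ⟨b + 1, hb⟩⟩ =
      A ⟨i, ⟨a, by omega⟩⟩ ⟨j, ⟨b, by omega⟩⟩ := by
  have h := congrFun (congrFun hA.eq ⟨i, ⟨a, by omega⟩⟩) ⟨j, ⟨b + 1, hb⟩⟩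
  rw [mul_blockDiagonal_jordanBlock_apply_succ, blockDiagonal_jordanBlock_mul_apply,
    dif_pos ha] at h
  exact h.symm

theorem apply_diag_of_commute
    (hA : Commute A (blockDiagonal' fun i => jordanBlock K (s i)))
    (i j : ι) (a : ℕ) (hi : a < s i) (hj : a < s j) :
    A ⟨i, ⟨a, hi⟩⟩ ⟨j, ⟨a, hj⟩⟩ = A ⟨i, ⟨0, by omega⟩⟩ ⟨j, ⟨0, by omega⟩⟩ := by
  induction a with
  | zero => rfl
  | succ a ih => rw [apply_succ_succ_of_commute hA, ih]

theorem apply_eq_zero_of_commute_of_lt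
    (hA : Commute A (blockDiagonal' fun i => jordanBlock K (s i)))
    (i j : ι) (a b : ℕ) (ha : a < s i) (hb : b < s j) (hba : b < a) :
    A ⟨i, ⟨a, ha⟩⟩ ⟨j, ⟨b, hb⟩⟩ = 0 := by
  induction b generalizing a with
  | zero =>
    obtain ⟨a, rfl⟩ := Nat.exists_eq_succ_of_ne_zero hba.ne'
    have h := congrFun (congrFun hA.eq ⟨i, ⟨a, by omega⟩⟩) ⟨j, ⟨0, hb⟩⟩
    rw [mul_blockDiagonal_jordanBlock_apply_zero, blockDiagonal_jordanBlock_mul_apply,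
      dif_pos ha] at h
    exact h.symm
  | succ b ih =>
    obtain ⟨a, rfl⟩ := Nat.exists_eq_succ_of_ne_zero (Nat.ne_zero_of_lt hba)
    rw [apply_succ_succ_of_commute hA]
    exact ih _ _ _ (by omega)

theorem apply_diag_eq_zero_of_commute_of_lt
    (hA : Commute A (blockDiagonal' fun i => jordanBlock K (s i)))
    (i j : ι) (a : ℕ) (hi : a < s i) (hj : a < s j) (hij : s i < s j) :
    A ⟨i, ⟨a, hi⟩⟩ ⟨j, ⟨a, hj⟩⟩ = 0 := by
  have h := congrFun (congrFun hA.eq ⟨i, ⟨s i - 1, by omega⟩⟩) ⟨j, ⟨s i - 1 + 1, by omega⟩⟩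
  rw [mul_blockDiagonal_jordanBlock_apply_succ, blockDiagonal_jordanBlock_mul_apply,
    dif_neg (by simp only; omega), apply_diag_of_commute hA] at h
  rw [apply_diag_of_commute hA, h]

/-- Orders a Jordan basis by position in the block, then by decreasing block size. -/
def jordanKey (s : ι → ℕ) (x : Σ i, Fin (s i)) : ℕ ×ₗ ℕᵒᵈ :=
  toLex ((x.2 : ℕ), OrderDual.toDual (s x.1))

theorem blockTriangular_jordanKey_of_commute
    (hA : Commute A (blockDiagonal' fun i => jordanBlock K (s i))) :
    A.BlockTriangular (jordanKey s) := by
  rintro ⟨i, a, ha⟩ ⟨j, b, hb⟩ hlt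
  rcases Prod.Lex.toLex_lt_toLex.mp hlt with h | ⟨h, h'⟩
  · exact apply_eq_zero_of_commute_of_lt hA i j a b ha hb h
  · obtain rfl : b = a := h
    exact apply_diag_eq_zero_of_commute_of_lt hA i j b ha hb h'

theorem det_toSquareBlock_jordanKey_of_commute
    (hA : Commute A (blockDiagonal' fun i => jordanBlock K (s i)))
    (a p : ℕ) (hp : 0 < p) (hap : a < p) :
    (A.toSquareBlock (jordanKey s) (toLex (a, OrderDual.toDual p))).det =
      (Matrix.of fun i j : {i // s i = p} =>
        A ⟨i, ⟨0, i.2.symm ▸ hp⟩⟩ ⟨j, ⟨0, j.2.symm ▸ hp⟩⟩).det := by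
  let e : {i // s i = p} ≃
      {x : Σ i, Fin (s i) // jordanKey s x = toLex (a, OrderDual.toDual p)} :=
    { toFun := fun i => ⟨⟨i, ⟨a, by omega⟩⟩, by
        simp only [jordanKey, i.2]⟩
      invFun := fun x => ⟨x.1.1, congrArg (fun z => OrderDual.ofDual (ofLex z).2) x.2⟩
      left_inv := fun i => rfl
      right_inv := by
        rintro ⟨⟨i, b, hb⟩, hx⟩
        obtain rfl : b = a := congrArg (fun z => (ofLex z).1) hx
        rfl }
  rw [← Matrix.det_submatrix_equiv_self e]
  congr 1
  ext i j
  exact apply_diag_of_commute hA i j a _ _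

theorem exists_pow_eq_det_of_commute_blockDiagonal_jordanBlock
    (hA : Commute A (blockDiagonal' fun i => jordanBlock K (s i)))
    (k : ℕ) (hk : ∀ i, k ∣ s i) : ∃ y : K, y ^ k = A.det := by
  set S : Finset (ℕ ×ₗ ℕᵒᵈ) := Finset.univ.image (jordanKey s)
  let size : ℕ ×ₗ ℕᵒᵈ → ℕ := fun z => OrderDual.ofDual (ofLex z).2
  have hmem (z : ℕ ×ₗ ℕᵒᵈ) (hz : z ∈ S) : ∃ i, s i = size z ∧ (ofLex z).1 < size z := by
    obtain ⟨x, -, rfl⟩ := Finset.mem_image.mp hz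
    exact ⟨x.1, rfl, x.2.2⟩
  have hblock (p : ℕ) (hp : p ∈ S.image size) :
      ∃ y : K, y ^ k = ∏ z ∈ S with size z = p, (A.toSquareBlock (jordanKey s) z).det := by
    obtain ⟨z, hz, rfl⟩ := Finset.mem_image.mp hp
    obtain ⟨i, hi, hlt⟩ := hmem z hz
    have hpos : 0 < size z := by omega
    have hfilter : S.filter (fun w => size w = size z) =
        (Finset.range (size z)).image (fun a => toLex (a, OrderDual.toDual (size z))) := by
      ext w
      rw [Finset.mem_filter]
      constructor
      · rintro ⟨hw, hwz⟩
        obtain ⟨-, -, hw'⟩ := hmem w hw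
        exact Finset.mem_image.mpr
          ⟨(ofLex w).1, Finset.mem_range.mpr (hwz ▸ hw'), by rw [← hwz]; rfl⟩
      · intro hw
        obtain ⟨a, ha, rfl⟩ := Finset.mem_image.mp hw
        rw [Finset.mem_range] at ha
        refine ⟨Finset.mem_image.mpr ⟨⟨i, ⟨a, by omega⟩⟩, Finset.mem_univ _, ?_⟩, rfl⟩
        simp only [jordanKey, hi]
    have hinj : Function.Injective
        (fun a : ℕ => (toLex (a, OrderDual.toDual (size z)) : ℕ ×ₗ ℕᵒᵈ)) :=
      fun a b hab => congrArg (fun z => (ofLex z).1) hab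
    obtain ⟨m, hm⟩ := hk i
    rw [hfilter, Finset.prod_image hinj.injOn, Finset.prod_congr rfl fun a ha =>
      det_toSquareBlock_jordanKey_of_commute hA a (size z) hpos (Finset.mem_range.mp ha),
      Finset.prod_const, Finset.card_range]
    have hmk : m * k = size z := by rw [mul_comm, ← hm, hi]
    exact ⟨_, (pow_mul _ m k).symm.trans (congrArg (HPow.hPow _) hmk)⟩
  choose! y hy using hblock
  refine ⟨∏ p ∈ S.image size, y p, ?_⟩
  rw [(blockTriangular_jordanKey_of_commute hA).det, ← Finset.prod_pow,
    Finset.prod_congr rfl hy]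
  exact Finset.prod_fiberwise_of_maps_to (fun z hz => Finset.mem_image_of_mem _ hz) _

end JordanCentralizer

/-- Let `M` be a nilpotent `n × n` matrix over `F_q` whose Jordan partition
has part-size invariant `k` (the gcd of its parts).  Then the determinant of
every element of the centralizer of `M` in `Mat_n(F_q)` is a `k`-th power in
`F_q`. -/
theorem stmt10 {K : Type*} [Field K] [Fintype K] {n : ℕ}
    (M : Matrix (Fin n) (Fin n) K) (lam : Nat.Partition n)
    (h : HasJordanPartition M lam) (k : ℕ) (hk : k = lam.parts.gcd)
    (A : Matrix (Fin n) (Fin n) K) (hA : Commute A M) :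
    ∃ y : K, y ^ k = A.det := by
  obtain ⟨L, hL, e, P, rfl⟩ := h
  set J := blockDiagonal' fun i => jordanBlock K (L.get i)
  set B : Matrix (Fin n) (Fin n) K := (↑P⁻¹ : Matrix _ _ K) * A * (P : Matrix _ _ K) with hB
  have hBJ : Commute B (reindex e e J) := by
    have := congrArg (fun X => (↑P⁻¹ : Matrix _ _ K) * X * (P : Matrix _ _ K)) hA.eq
    simpa [Commute, SemiconjBy, hB, mul_assoc] using this
  have hcomm : Commute ((reindexAlgEquiv K K e).symm B) J := by
    simpa using hBJ.map (reindexAlgEquiv K K e).symm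
  obtain ⟨y, hy⟩ := exists_pow_eq_det_of_commute_blockDiagonal_jordanBlock hcomm k fun i => by
    rw [hk, ← hL]
    exact Multiset.gcd_dvd (Multiset.mem_coe.mpr (List.get_mem L i))
  refine ⟨y, hy.trans ?_⟩
  rw [symm_reindexAlgEquiv, coe_reindexAlgEquiv, det_reindex_self, hB]
  exact det_units_conj' P A
end

section
/- Let λ = (h_1,…,h_k) be a partition of n with h_1 ≥ ⋯ ≥ h_k. Over any field, the single Jordan block J(n) commutes with some conjugate of J(λ) if and only if h_1 − h_k ≤ 1. -/
open Polynomial Matrix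

theorem jordanBlock_pow_apply (K : Type*) [Field K] (p m : ℕ) (i j : Fin p) :
    (jordanBlock K p ^ m) i j = if (i : ℕ) + m = j then 1 else 0 := by
  induction m generalizing i with
  | zero => simp [Matrix.one_apply, Fin.ext_iff]
  | succ m ih =>
    have hJ : ∀ x y, jordanBlock K p x y = if (x : ℕ) + 1 = y then 1 else 0 := fun _ _ => rfl
    rw [pow_succ', Matrix.mul_apply]
    simp only [ih, hJ, ite_mul, one_mul, zero_mul]
    by_cases hi : (i : ℕ) + 1 < p
    · rw [Finset.sum_eq_single ⟨i + 1, hi⟩]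
      · simp [add_assoc, add_comm 1 m]
      · intro b _ hb
        rw [if_neg]
        exact fun h => hb (Fin.ext h.symm)
      · simp
    · rw [Finset.sum_eq_zero, if_neg]
      · omega
      · intro x _
        rw [if_neg]
        omega

theorem jordanBlock_pow_self (K : Type*) [Field K] (p : ℕ) : jordanBlock K p ^ p = 0 := by
  ext i j
  rw [jordanBlock_pow_apply, if_neg (by omega), Matrix.zero_apply]

theorem rank_eq_card_of_mulVec_eq_zero_iff {K ι : Type*} [Field K] [Fintype ι] [DecidableEq ι]
    (M : Matrix ι ι K) (s : Finset ι)
    (h : ∀ v, M *ᵥ v = 0 ↔ ∀ y ∈ s, v y = 0) : M.rank = s.card := by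
  have hker : LinearMap.ker M.mulVecLin
      = ⨅ i ∈ (↑s : Set ι), LinearMap.ker (LinearMap.proj i : (ι → K) →ₗ[K] K) := by
    ext v
    simp [h]
  have hd : Disjoint ((↑sᶜ : Set ι)) (↑s : Set ι) := by
    simpa using disjoint_compl_left
  have e := (LinearMap.iInfKerProjEquiv K (fun _ : ι => K) hd
    (by intro i _; simp)).finrank_eq
  rw [← hker] at e
  have h1 := LinearMap.finrank_range_add_finrank_ker M.mulVecLin
  rw [e] at h1
  have h2 := Finset.card_add_card_compl s
  simp only [Module.finrank_fintype_fun_eq_card] at h1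
  have h3 : Fintype.card (↑(↑sᶜ : Set ι)) = sᶜ.card := Fintype.card_coe _
  rw [Matrix.rank]
  omega

theorem jordanBlock_pow_mulVec_eq_zero_iff {K : Type*} [Field K] (p m : ℕ) (v : Fin p → K) :
    (jordanBlock K p ^ m) *ᵥ v = 0 ↔ ∀ y : Fin p, m ≤ (y : ℕ) → v y = 0 := by
  have key : ∀ (x y : Fin p), (x : ℕ) + m = y → ((jordanBlock K p ^ m) *ᵥ v) x = v y := by
    intro x y hxy
    simp only [Matrix.mulVec, dotProduct, jordanBlock_pow_apply, hxy]
    simp [Fin.val_inj]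
  constructor
  · intro h y hy
    rw [← key ⟨y - m, by omega⟩ y (by simp [hy]), h, Pi.zero_apply]
  · intro h
    ext x
    by_cases hx : (x : ℕ) + m < p
    · rw [key x ⟨x + m, hx⟩ rfl, h _ (by simp), Pi.zero_apply]
    · simp only [Matrix.mulVec, dotProduct, jordanBlock_pow_apply, Pi.zero_apply]
      refine Finset.sum_eq_zero fun y _ => ?_
      rw [if_neg (by omega), zero_mul]

theorem card_filter_le_val (p m : ℕ) :
    (Finset.univ.filter fun y : Fin p => m ≤ (y : ℕ)).card = p - m := by
  rw [← Finset.card_map Fin.valEmbedding, ← Nat.card_Ico]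
  congr 1
  ext y
  simp only [Finset.mem_map, Finset.mem_filter, Finset.mem_univ, true_and, Fin.valEmbedding_apply,
    Finset.mem_Ico]
  exact ⟨fun ⟨z, hz, h⟩ => h ▸ ⟨hz, z.2⟩, fun h => ⟨⟨y, h.2⟩, h.1, rfl⟩⟩

theorem rank_jordanBlock_pow (K : Type*) [Field K] (p m : ℕ) :
    (jordanBlock K p ^ m).rank = p - m := by
  rw [rank_eq_card_of_mulVec_eq_zero_iff _ (Finset.univ.filter fun y : Fin p => m ≤ (y : ℕ)),
    card_filter_le_val]
  simpa using jordanBlock_pow_mulVec_eq_zero_iff p m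

theorem rank_blockDiagonal'_jordanBlock_pow (K : Type*) [Field K] {k : ℕ} (h : Fin k → ℕ) (m : ℕ) :
    ((Matrix.blockDiagonal' fun i => jordanBlock K (h i)) ^ m).rank = ∑ i, (h i - m) := by
  rw [← Matrix.blockDiagonal'_pow, rank_eq_card_of_mulVec_eq_zero_iff _
    (Finset.univ.sigma fun i => Finset.univ.filter fun y : Fin (h i) => m ≤ (y : ℕ)),
    Finset.card_sigma]
  · simp only [card_filter_le_val]
  · intro v
    have key : ∀ x : (i : Fin k) × Fin (h i),
        (Matrix.blockDiagonal' ((fun i => jordanBlock K (h i)) ^ m) *ᵥ v) x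
          = ((jordanBlock K (h x.1) ^ m) *ᵥ fun t => v ⟨x.1, t⟩) x.2 := by
      rintro ⟨i, t⟩
      simp only [Matrix.mulVec, dotProduct, Fintype.sum_sigma]
      rw [Finset.sum_eq_single i]
      · simp [Matrix.blockDiagonal'_apply_eq]
      · intro j _ hj
        simp [Matrix.blockDiagonal'_apply_ne _ _ _ hj.symm]
      · simp
    have hz := fun i => jordanBlock_pow_mulVec_eq_zero_iff (h i) m fun t => v ⟨i, t⟩
    simp only [Finset.mem_sigma, Finset.mem_filter, Finset.mem_univ, true_and, Sigma.forall, ← hz]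
    simp only [funext_iff, key, Sigma.forall, Pi.zero_apply]

theorem rank_pow_of_similarMat_blockDiagonal' {K : Type*} [Field K] {n : ℕ} {M : Matrix (Fin n) (Fin n) K}
    {L : List ℕ} (e : ((i : Fin L.length) × Fin (L.get i)) ≃ Fin n)
    (h : SimilarMat (Matrix.reindex e e (Matrix.blockDiagonal' fun i => jordanBlock K (L.get i))) M)
    (m : ℕ) : (M ^ m).rank = ∑ i, (L.get i - m) := by
  obtain ⟨P, rfl⟩ := h
  rw [Units.conj_pow, Matrix.rank_mul_eq_left_of_isUnit_det, Matrix.rank_mul_eq_right_of_isUnit_det,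
    ← rank_blockDiagonal'_jordanBlock_pow K L.get m]
  · rw [← Matrix.coe_reindexAlgEquiv K K, ← map_pow, Matrix.coe_reindexAlgEquiv,
      Matrix.rank_reindex]
  · exact (Matrix.isUnit_iff_isUnit_det _).1 P.isUnit
  · exact (Matrix.isUnit_iff_isUnit_det _).1 P⁻¹.isUnit

theorem exists_aeval_eq_of_commute_jordanBlock {K : Type*} [Field K] {n : ℕ}
    {Y : Matrix (Fin n) (Fin n) K} (hY : Commute (jordanBlock K n) Y) :
    ∃ p : K[X], Y = aeval (jordanBlock K n) p := by
  rcases Nat.eq_zero_or_pos n with rfl | hn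
  · exact ⟨0, Subsingleton.elim _ _⟩
  let z : Fin n := ⟨0, hn⟩
  have hrow : ∀ (Z : Matrix (Fin n) (Fin n) K) (i : Fin n),
      (jordanBlock K n ^ (i : ℕ) * Z) z = Z i := by
    intro Z i
    ext j
    simp [Matrix.mul_apply, jordanBlock_pow_apply, z, Fin.val_inj]
  have hext : ∀ Z : Matrix (Fin n) (Fin n) K, Commute (jordanBlock K n) Z → Y z = Z z → Y = Z := by
    intro Z hZ h
    ext i j
    rw [← hrow Y, ← hrow Z, (hY.pow_left _).eq, (hZ.pow_left _).eq, Matrix.mul_apply,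
      Matrix.mul_apply, h]
  refine ⟨∑ j : Fin n, C (Y z j) * X ^ (j : ℕ), hext _ ?_ ?_⟩
  · conv_lhs => rw [← aeval_X (R := K) (jordanBlock K n)]
    exact (Commute.all (X : K[X]) _).map _
  · ext j
    simp [Matrix.sum_apply, ← Algebra.smul_def, jordanBlock_pow_apply, z, Fin.val_inj]

theorem exists_eq_jordanBlock_pow_mul_of_commute {K : Type*} [Field K] {n : ℕ}
    {Y : Matrix (Fin n) (Fin n) K} (hY : Commute (jordanBlock K n) Y) :
    ∃ (r : ℕ) (U : Matrix (Fin n) (Fin n) K), IsUnit U ∧ Commute (jordanBlock K n) U ∧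
      Y = jordanBlock K n ^ r * U := by
  obtain ⟨p, rfl⟩ := exists_aeval_eq_of_commute_jordanBlock hY
  by_cases hp : p = 0
  · exact ⟨n, 1, isUnit_one, Commute.one_right _, by simp [hp, jordanBlock_pow_self]⟩
  obtain ⟨u, hu, hd⟩ := exists_eq_pow_rootMultiplicity_mul_and_not_dvd p hp 0
  rw [C_0, sub_zero] at hu hd
  refine ⟨p.rootMultiplicity 0, aeval (jordanBlock K n) u, ?_, ?_, ?_⟩
  · obtain ⟨a, b, hab⟩ := ((irreducible_X.coprime_iff_not_dvd.2 hd).pow_left (m := n))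
    have h := congrArg (aeval (jordanBlock K n)) hab
    simp only [map_add, map_mul, map_pow, aeval_X, jordanBlock_pow_self, mul_zero, zero_add,
      map_one] at h
    exact IsUnit.of_mul_eq_one_right _ h
  · conv_lhs => rw [← aeval_X (R := K) (jordanBlock K n)]
    exact (Commute.all (X : K[X]) _).map _
  · conv_lhs => rw [hu]
    simp

theorem exists_rank_pow_of_commute_jordanBlock {K : Type*} [Field K] {n : ℕ}
    {Y : Matrix (Fin n) (Fin n) K} (hY : Commute (jordanBlock K n) Y) :
    ∃ r : ℕ, ∀ m, (Y ^ m).rank = n - r * m := by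
  obtain ⟨r, U, hU, hc, rfl⟩ := exists_eq_jordanBlock_pow_mul_of_commute hY
  refine ⟨r, fun m => ?_⟩
  rw [(hc.pow_left r).mul_pow, ← pow_mul, Matrix.rank_mul_eq_left_of_isUnit_det,
    rank_jordanBlock_pow]
  exact (Matrix.isUnit_iff_isUnit_det _).1 (hU.pow m)

theorem le_succ_of_sum_sub_eq {ι : Type*} [Fintype ι] {h : ι → ℕ} {n r : ℕ} (hpos : ∀ i, 0 < h i)
    (hsum : ∀ m, ∑ i, (h i - m) = n - r * m) (a b : ι) : h a ≤ h b + 1 := by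
  by_contra! hab
  have hlt : ∑ i, ((h i - h b) + (h i - 1)) < ∑ i, ((h i - 0) + (h i - (h b + 1))) := by
    refine Finset.sum_lt_sum (fun i _ => ?_) ⟨b, Finset.mem_univ _, ?_⟩
    · have := hpos i; have := hpos b; omega
    · have := hpos b; omega
  have hone : 0 < ∑ i, (h i - (h b + 1)) :=
    Finset.sum_pos' (fun _ _ => Nat.zero_le _) ⟨a, Finset.mem_univ _, by omega⟩
  simp only [Finset.sum_add_distrib, hsum, mul_add, mul_one, mul_zero] at hlt hone
  omega

theorem exists_hasJordanPartition_jordanBlock_pow (K : Type*) [Field K] {n k s q : ℕ}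
    (hs : s < k) (hn : n = k * q + s) (lam : Nat.Partition n)
    (hlam : lam.parts = Multiset.replicate s (q + 1) + Multiset.replicate (k - s) q) :
    HasJordanPartition (jordanBlock K n ^ k) lam := by
  set L := List.replicate s (q + 1) ++ List.replicate (k - s) q with hL
  have hlen : L.length = k := by simp [hL]; omega
  have hget : ∀ i : Fin L.length, L.get i = if (i : ℕ) < s then q + 1 else q := by
    intro i
    simp [hL, List.getElem_append]
  have hlt : ∀ x : (i : Fin L.length) × Fin (L.get i), (x.1 : ℕ) + k * x.2 < n := by
    rintro ⟨i, t⟩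
    have ht : (t : ℕ) < if (i : ℕ) < s then q + 1 else q := hget i ▸ t.2
    have hi : (i : ℕ) < k := hlen ▸ i.2
    dsimp only
    split_ifs at ht with h
    · have := Nat.mul_le_mul_left k (Nat.lt_succ_iff.1 ht)
      omega
    · have := Nat.mul_le_mul_left k (Nat.succ_le_iff.2 ht)
      rw [Nat.mul_succ] at this
      omega
  let f : ((i : Fin L.length) × Fin (L.get i)) → Fin n := fun x => ⟨x.1 + k * x.2, hlt x⟩
  have hkey : ∀ (i j : Fin L.length) (t u : ℕ), (i : ℕ) + k * t = j + k * u → i = j ∧ t = u := by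
    intro i j t u h
    have hi : (i : ℕ) < k := hlen ▸ i.2
    have hj : (j : ℕ) < k := hlen ▸ j.2
    have h1 := congrArg (· % k) h
    have h2 := congrArg (· / k) h
    simp only [Nat.add_mul_mod_self_left, Nat.mod_eq_of_lt hi, Nat.mod_eq_of_lt hj] at h1
    simp only [Nat.add_mul_div_left _ _ (Nat.zero_lt_of_lt hi), Nat.div_eq_of_lt hi,
      Nat.div_eq_of_lt hj, zero_add] at h2
    exact ⟨Fin.ext h1, h2⟩
  have hcoe : (L : Multiset ℕ) = lam.parts := by
    rw [hlam, hL, ← Multiset.coe_add, Multiset.coe_replicate, Multiset.coe_replicate]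
  have hinj : Function.Injective f := by
    rintro ⟨i, t⟩ ⟨j, u⟩ h
    obtain ⟨rfl, h2⟩ := hkey i j t u (congrArg Fin.val h)
    rw [Fin.ext h2]
  have hcard : Fintype.card ((i : Fin L.length) × Fin (L.get i)) = Fintype.card (Fin n) := by
    have : L.sum = n := by rw [← Multiset.sum_coe, hcoe, lam.parts_sum]
    simp only [Fintype.card_sigma, Fintype.card_fin]
    rw [← this]
    exact Fin.sum_univ_getElem L
  let e := Equiv.ofBijective f ((Fintype.bijective_iff_injective_and_card f).2 ⟨hinj, hcard⟩)
  refine ⟨L, hcoe, e, 1, ?_⟩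
  simp only [Units.val_one, inv_one, one_mul, mul_one]
  rw [← Equiv.symm_apply_eq]
  ext ⟨i, t⟩ ⟨j, u⟩
  have he : ∀ x, ((e x : Fin n) : ℕ) = x.1 + k * x.2 := fun _ => rfl
  simp only [Matrix.reindex_symm, Matrix.reindex_apply, Matrix.submatrix_apply, Equiv.symm_symm,
    jordanBlock_pow_apply, he]
  by_cases hij : i = j
  · subst hij
    rw [Matrix.blockDiagonal'_apply_eq, jordanBlock, Matrix.of_apply]
    refine if_congr ⟨fun h => (hkey i i (t + 1) u (by rw [← h]; ring)).2, fun h => ?_⟩ rfl rfl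
    rw [← h]; ring
  · rw [Matrix.blockDiagonal'_apply_ne _ _ _ hij, if_neg]
    exact fun h => hij (hkey i j (t + 1) u (by rw [← h]; ring)).1

theorem Multiset.exists_eq_replicate_add_replicate {s : Multiset ℕ} (hs : s ≠ 0)
    (h : ∀ a ∈ s, ∀ b ∈ s, a ≤ b + 1) :
    ∃ q c d : ℕ, 0 < d ∧ s = Multiset.replicate c (q + 1) + Multiset.replicate d q := by
  obtain ⟨q, hq, hmin⟩ : ∃ q ∈ s, ∀ a ∈ s, q ≤ a := by
    obtain ⟨a, ha⟩ := Multiset.exists_mem_of_ne_zero hs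
    classical
    have hex : ∃ a, a ∈ s := ⟨a, ha⟩
    exact ⟨Nat.find hex, Nat.find_spec hex, fun b hb => Nat.find_min' hex hb⟩
  refine ⟨q, s.count (q + 1), s.count q, Multiset.count_pos.2 hq, ?_⟩
  ext a
  rw [Multiset.count_add, Multiset.count_replicate, Multiset.count_replicate]
  by_cases ha : a ∈ s
  · have h1 := hmin a ha
    have h2 := h a ha q hq
    obtain rfl | rfl : a = q ∨ a = q + 1 := by omega
    · simp
    · simp
  · rw [Multiset.count_eq_zero_of_notMem ha]
    split_ifs with h1 h2 h2 <;> simp_all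

/-- Let `λ` be a partition of `n ≥ 1`.  Over any field, the single Jordan
block `J(n)` commutes with some conjugate of `J(λ)` if and only if the largest
part of `λ` exceeds the smallest part by at most `1`. -/
theorem stmt11 {K : Type*} [Field K] {n : ℕ} (hn : 0 < n) (lam : Nat.Partition n) :
    (∃ Y : Matrix (Fin n) (Fin n) K,
        HasJordanPartition Y lam ∧ Commute (jordanBlock K n) Y) ↔
      ∀ a ∈ lam.parts, ∀ b ∈ lam.parts, a ≤ b + 1 := by
  constructor
  · rintro ⟨Y, ⟨L, hL, e, hsim⟩, hcomm⟩ a ha b hb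
    obtain ⟨r, hr⟩ := exists_rank_pow_of_commute_jordanBlock hcomm
    rw [← hL, Multiset.mem_coe, List.mem_iff_get] at ha hb
    obtain ⟨i, rfl⟩ := ha
    obtain ⟨j, rfl⟩ := hb
    refine le_succ_of_sum_sub_eq (h := L.get) (n := n) (r := r) (fun i => ?_) (fun m => ?_) i j
    · exact lam.parts_pos (hL ▸ Multiset.mem_coe.2 (L.get_mem i))
    · rw [← hr, rank_pow_of_similarMat_blockDiagonal' e hsim]
  · intro h
    have hne : lam.parts ≠ 0 := by
      intro h0
      have := lam.parts_sum
      rw [h0, Multiset.sum_zero] at this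
      omega
    obtain ⟨q, c, d, hd, hparts⟩ := Multiset.exists_eq_replicate_add_replicate hne h
    refine ⟨jordanBlock K n ^ (c + d), ?_, (Commute.refl _).pow_right _⟩
    refine exists_hasJordanPartition_jordanBlock_pow K (s := c) (q := q) (by omega) ?_ lam
      (by rw [hparts, Nat.add_sub_cancel_left])
    have := lam.parts_sum
    rw [hparts] at this
    simp only [Multiset.sum_add, Multiset.sum_replicate, smul_eq_mul] at this
    rw [← this]; ring
end

section
/- Let λ be a partition of n and let λ̄ be its conjugate partition. Then over any field the nilpotent similarity classes N(λ) and N(λ̄) commute. -/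
open Polynomial Matrix

/-- The multiset of parts of the conjugate partition of a partition with parts
`s`: the `j`-th part (for `1 ≤ j ≤` largest part) is the number of elements of
`s` of size at least `j`. -/
def conjParts (s : Multiset ℕ) : Multiset ℕ :=
  (((Finset.Icc 1 s.sum).val.map fun j => Multiset.card (s.filter fun p => j ≤ p)).filter
    fun c => 0 < c)

/-- The cells of a Young diagram, indexed by a row and a position in that row. -/
def rowCell (μ : YoungDiagram) (x : (i : Fin μ.rowLens.length) × Fin (μ.rowLens.get i)) : ℕ × ℕ :=
  (x.1, x.2)

lemma rowCell_injective (μ : YoungDiagram) : Function.Injective (rowCell μ) := by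
  rintro ⟨i, a⟩ ⟨j, b⟩ h
  simp only [rowCell, Prod.mk.injEq] at h
  obtain ⟨h₁, h₂⟩ := h
  obtain rfl := Fin.ext h₁
  obtain rfl := Fin.ext h₂
  rfl

lemma range_rowCell (μ : YoungDiagram) : Set.range (rowCell μ) = {c | c ∈ μ} := by
  ext ⟨i, j⟩
  constructor
  · rintro ⟨⟨a, b⟩, h⟩
    have hb : (b : ℕ) < μ.rowLen a :=
      b.2.trans_eq (by rw [List.get_eq_getElem, YoungDiagram.get_rowLens])
    rw [← h]
    exact YoungDiagram.mem_iff_lt_rowLen.2 hb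
  · intro h
    have hi : i < μ.rowLens.length := by
      rw [YoungDiagram.length_rowLens, ← YoungDiagram.mem_iff_lt_colLen]
      exact μ.up_left_mem le_rfl (Nat.zero_le j) h
    refine ⟨⟨⟨i, hi⟩, ⟨j, ?_⟩⟩, rfl⟩
    rw [List.get_eq_getElem, YoungDiagram.get_rowLens]
    exact YoungDiagram.mem_iff_lt_rowLen.1 h

/-- The matrix of the shift along rows, for basis vectors placed at the positions `c`. -/
def rowShift (K : Type*) [Zero K] [One K] {ι : Type*} (c : ι → ℕ × ℕ) : Matrix ι ι K :=
  Matrix.of fun a b => if c b = ((c a).1, (c a).2 + 1) then 1 else 0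

lemma hasJordanPartition_rowShift {K : Type*} [Field K] {n : ℕ} (μ : YoungDiagram)
    (p : Nat.Partition n) (hp : (μ.rowLens : Multiset ℕ) = p.parts) (c : Fin n → ℕ × ℕ)
    (hc : Function.Injective c) (hr : Set.range c = {x | x ∈ μ}) :
    HasJordanPartition (rowShift K c) p := by
  let e := (Equiv.ofInjective _ (rowCell_injective μ)).trans
    ((Equiv.setCongr ((range_rowCell μ).trans hr.symm)).trans (Equiv.ofInjective c hc).symm)
  have he : ∀ x, c (e x) = rowCell μ x := fun x =>
    Equiv.apply_ofInjective_symm hc _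
  refine ⟨μ.rowLens, hp, e, 1, ?_⟩
  ext a b
  obtain ⟨⟨i, x⟩, rfl⟩ := e.surjective a
  obtain ⟨⟨j, y⟩, rfl⟩ := e.surjective b
  simp only [rowShift, Matrix.of_apply, he, rowCell, Units.val_one, inv_one, one_mul, mul_one,
    Matrix.reindex_apply, Matrix.submatrix_apply, Equiv.symm_apply_apply, Prod.mk.injEq]
  by_cases hij : i = j
  · subst hij
    simp [Matrix.blockDiagonal'_apply_eq, jordanBlock, eq_comm]
  · rw [Matrix.blockDiagonal'_apply_ne _ _ _ hij, if_neg]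
    exact fun h => hij (Fin.ext h.1.symm)

lemma rowShift_mul_rowShift_swap (K : Type*) [Field K] {ι : Type*} [Fintype ι]
    (μ : YoungDiagram) (c : ι → ℕ × ℕ) (hc : Function.Injective c)
    (hr : Set.range c = {x | x ∈ μ}) (a b : ι) :
    (rowShift K c * rowShift K (Prod.swap ∘ c)) a b =
      if c b = ((c a).1 + 1, (c a).2 + 1) then 1 else 0 := by
  classical
  simp only [Matrix.mul_apply, rowShift, Matrix.of_apply, ← ite_and, mul_ite, mul_one, mul_zero,
    Function.comp_apply, Prod.ext_iff, Prod.fst_swap, Prod.snd_swap]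
  split_ifs with h
  · have hb : c b ∈ μ := hr.subset ⟨b, rfl⟩
    have hd : ((c a).1, (c a).2 + 1) ∈ μ :=
      μ.up_left_mem (by omega) (by omega) hb
    obtain ⟨d, hd⟩ := hr.superset hd
    rw [Finset.sum_eq_single d]
    · rw [if_pos]
      simp [hd, h]
    · intro x _ hx
      refine if_neg fun hh => hx (hc ?_)
      rw [hd]
      ext
      · simp only; omega
      · simp only; omega
    · simp
  · refine Finset.sum_eq_zero fun x _ => if_neg fun hh => h ?_
    omega

lemma range_swap_comp {ι : Type*} (μ : YoungDiagram) (c : ι → ℕ × ℕ)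
    (hr : Set.range c = {x | x ∈ μ}) :
    Set.range (Prod.swap ∘ c) = {x | x ∈ μ.transpose} := by
  rw [Set.range_comp, hr, Set.image_swap_eq_preimage_swap]
  ext x
  simp [YoungDiagram.mem_transpose]

lemma commute_rowShift_swap (K : Type*) [Field K] {ι : Type*} [Fintype ι]
    (μ : YoungDiagram) (c : ι → ℕ × ℕ) (hc : Function.Injective c)
    (hr : Set.range c = {x | x ∈ μ}) :
    Commute (rowShift K c) (rowShift K (Prod.swap ∘ c)) := by
  ext a b
  rw [rowShift_mul_rowShift_swap K μ c hc hr]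
  have := rowShift_mul_rowShift_swap K μ.transpose (Prod.swap ∘ c)
    (Prod.swap_injective.comp hc) (range_swap_comp μ c hr) a b
  rw [← Function.comp_assoc, Prod.swap_swap_eq, Function.id_comp] at this
  rw [this]
  simp [Prod.ext_iff, and_comm]

lemma card_filter_rowLens (μ : YoungDiagram) (j : ℕ) :
    ((μ.rowLens : Multiset ℕ).filter fun p => j + 1 ≤ p).card = μ.colLen j := by
  have h : (μ.rowLens : Multiset ℕ) = (Multiset.range (μ.colLen 0)).map μ.rowLen := rfl
  rw [h, Multiset.filter_map, Multiset.card_map]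
  have : (Finset.range (μ.colLen 0)).filter (fun i => j + 1 ≤ μ.rowLen i) =
      Finset.range (μ.colLen j) := by
    ext i
    have := μ.colLen_anti 0 j (Nat.zero_le j)
    simp only [Finset.mem_filter, Finset.mem_range, Nat.succ_le_iff,
      ← YoungDiagram.mem_iff_lt_rowLen, ← YoungDiagram.mem_iff_lt_colLen]
    exact ⟨fun h => h.2, fun h => ⟨μ.up_left_mem le_rfl (Nat.zero_le j) h, h⟩⟩
  exact (congrArg Finset.card this).trans (Finset.card_range _)

lemma rowLen_zero_le_sum_rowLens (μ : YoungDiagram) : μ.rowLen 0 ≤ μ.rowLens.sum := by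
  rcases Nat.eq_zero_or_pos (μ.rowLen 0) with h | h
  · omega
  · refine List.le_sum_of_mem (List.mem_map.2 ⟨0, ?_, rfl⟩)
    rw [List.mem_range, ← YoungDiagram.mem_iff_lt_colLen]
    exact YoungDiagram.mem_iff_lt_rowLen.2 h

lemma conjParts_rowLens (μ : YoungDiagram) :
    conjParts (μ.rowLens : Multiset ℕ) = (μ.transpose.rowLens : Multiset ℕ) := by
  have h : (μ.transpose.rowLens : Multiset ℕ) =
      (Multiset.range (μ.rowLen 0)).map μ.colLen := by
    have hf : μ.transpose.rowLen = μ.colLen := funext μ.rowLen_transpose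
    simp [YoungDiagram.rowLens, Multiset.range, hf]
  have hI : (Finset.Icc 1 (μ.rowLens : Multiset ℕ).sum).val =
      (Multiset.range μ.rowLens.sum).map Nat.succ := by
    have : Finset.Icc 1 (μ.rowLens : Multiset ℕ).sum =
        (Finset.range μ.rowLens.sum).map ⟨Nat.succ, Nat.succ_injective⟩ := by
      ext x
      simp only [Multiset.sum_coe, Finset.mem_Icc, Finset.mem_map, Finset.mem_range,
        Function.Embedding.coeFn_mk]
      exact ⟨fun h => ⟨x - 1, by omega, by omega⟩, fun ⟨y, hy⟩ => by omega⟩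
    rw [this]
    rfl
  rw [conjParts, hI, h, Multiset.map_map]
  simp only [Function.comp_def, Nat.succ_eq_add_one, card_filter_rowLens]
  rw [Multiset.filter_map]
  congr 1
  have : (Finset.range μ.rowLens.sum).filter (fun j => 0 < μ.colLen j) =
      Finset.range (μ.rowLen 0) := by
    ext j
    have := rowLen_zero_le_sum_rowLens μ
    simp only [Finset.mem_filter, Finset.mem_range, ← YoungDiagram.mem_iff_lt_colLen,
      YoungDiagram.mem_iff_lt_rowLen]
    omega
  exact congrArg Finset.val this

lemma exists_youngDiagram_rowLens {n : ℕ} (p : Nat.Partition n) :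
    ∃ μ : YoungDiagram, (μ.rowLens : Multiset ℕ) = p.parts := by
  have hs : (p.parts.sort (· ≥ ·)).SortedGE := (p.parts.pairwise_sort (· ≥ ·)).sortedGE
  refine ⟨YoungDiagram.ofRowLens _ hs, ?_⟩
  rw [YoungDiagram.rowLens_ofRowLens_eq_self, Multiset.sort_eq]
  intro x hx
  exact p.parts_pos ((Multiset.mem_sort _).1 hx)

/-- Let `λ` be a partition of `n` and `λ̄` its conjugate partition.  Then over
any field the nilpotent similarity classes `N(λ)` and `N(λ̄)` commute. -/
theorem stmt13 {K : Type*} [Field K] {n : ℕ} (lam mu : Nat.Partition n)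
    (h : mu.parts = conjParts lam.parts) :
    ∃ X Y : Matrix (Fin n) (Fin n) K,
      HasJordanPartition X lam ∧ HasJordanPartition Y mu ∧ Commute X Y := by
  obtain ⟨μ, hμ⟩ := exists_youngDiagram_rowLens lam
  have hcard : Fintype.card ((i : Fin μ.rowLens.length) × Fin (μ.rowLens.get i)) = n := by
    rw [Fintype.card_sigma]
    simp only [Fintype.card_fin]
    rw [← List.sum_ofFn, List.ofFn_get, ← Multiset.sum_coe, hμ, lam.parts_sum]
  let c : Fin n → ℕ × ℕ := rowCell μ ∘ (Fintype.equivFinOfCardEq hcard).symm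
  have hc : Function.Injective c := (rowCell_injective μ).comp (Equiv.injective _)
  have hr : Set.range c = {x | x ∈ μ} := by
    rw [(Equiv.surjective _).range_comp, range_rowCell]
  refine ⟨rowShift K c, rowShift K (Prod.swap ∘ c),
    hasJordanPartition_rowShift μ lam hμ c hc hr,
    hasJordanPartition_rowShift μ.transpose mu ?_ _ (Prod.swap_injective.comp hc) ?_,
    commute_rowShift_swap K μ c hc hr⟩
  · rw [h, ← hμ, conjParts_rowLens]
  · exact range_swap_comp μ c hr
end
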